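/- arXiv:1904.03950 — 8 statements merged into one kernel-verified Lean document; each statement's English description precedes it below -/
import Mathlib

section
/- Let F be a field, c ≥ 1, and d₁, …, d_c positive integers with d₁ + … + d_c = n. Let P = [U₁, …, U_c] ∈ M(n,F) be the n×n matrix obtained by horizontally concatenating blocks U_i ∈ M(n×d_i, F), and suppose det(P) ≠ 0. Then there exists a partition [n] = T₁ ⊎ T₂ ⊎ … ⊎ T_c with |T_i| = d_i for each i, such that for every i ∈ [c] the d_i×d_i submatrix of U_i consisting of the rows indexed by T_i has rank d_i (i.e., is invertible). -/
open Matrix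

/-- If a matrix whose columns are coloured by `b` has nonzero determinant, then its rows can be
coloured so that zeroing the entries with mismatched colours keeps the determinant nonzero. -/
lemma Matrix.exists_det_ite_ne_zero {F m ι : Type*} [CommRing F] [Fintype m] [DecidableEq m]
    [Fintype ι] [DecidableEq ι] (b : m → ι) (M : Matrix m m F) (hM : M.det ≠ 0) :
    ∃ f : m → ι, (Matrix.of fun r j => if b j = f r then M r j else 0).det ≠ 0 := by
  by_contra! h
  refine hM ?_
  have key := (Matrix.detRowAlternating (R := F) (n := m)).toMultilinearMap.map_sum
    (fun (r : m) (i : ι) (j : m) => if b j = i then M r j else 0)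
  have hrow : (fun r : m => ∑ i : ι, fun j : m => if b j = i then M r j else 0) = M := by
    ext r j
    simp [Finset.sum_apply]
  rw [hrow] at key
  exact key.trans (Finset.sum_eq_zero fun f _ => h f)

/-- If a matrix with columns `k` supported on the rows in `T` has linearly independent columns, then
its restriction to the rows in `T` has full column rank. -/
lemma Matrix.rank_submatrix_of_linearIndependent_ite {F m n : Type*} [Field F] [Fintype n]
    [DecidableEq m] (T : Finset m) (A : Matrix m n F)
    (h : LinearIndependent F fun (k : n) (r : m) => if r ∈ T then A r k else 0) :
    (A.submatrix (fun r : {x : m // x ∈ T} => (r : m)) id).rank = Fintype.card n := by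
  let L : ({x : m // x ∈ T} → F) →ₗ[F] (m → F) :=
    { toFun := fun g r => if hr : r ∈ T then g ⟨r, hr⟩ else 0
      map_add' := fun g g' => by ext r; by_cases hr : r ∈ T <;> simp [hr]
      map_smul' := fun a g => by ext r; by_cases hr : r ∈ T <;> simp [hr] }
  rw [← Matrix.rank_transpose]
  refine LinearIndependent.rank_matrix (LinearIndependent.of_comp L ?_)
  convert h using 1
  ext k r
  by_cases hr : r ∈ T <;> simp [L, hr]

/-- Laplace expansion lemma: If `P = [U₁, …, U_c]` is an invertible `n×n` matrix
obtained by concatenating blocks `U_i` of sizes `n × d_i` with `d₁ + … + d_c = n`, then there is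
a partition `[n] = T₁ ⊎ … ⊎ T_c` with `|T_i| = d_i` such that for each `i`, the `d_i × d_i`
submatrix of `U_i` with rows indexed by `T_i` has rank `d_i`. -/
theorem stmt_5 (F : Type) [Field F] (n c : ℕ) (hc : 1 ≤ c)
    (d : Fin c → ℕ) (hd : ∀ i, 0 < d i) (hsum : ∑ i, d i = n)
    (U : (i : Fin c) → Matrix (Fin n) (Fin (d i)) F)
    (e : ((i : Fin c) × Fin (d i)) ≃ Fin n)
    (hdet : (Matrix.of fun (r j : Fin n) => U (e.symm j).1 r (e.symm j).2).det ≠ 0) :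
    ∃ T : Fin c → Finset (Fin n),
      (∀ i j, i ≠ j → Disjoint (T i) (T j)) ∧
      (∀ v : Fin n, ∃ i, v ∈ T i) ∧
      (∀ i, (T i).card = d i) ∧
      (∀ i, ((U i).submatrix (fun r : {x : Fin n // x ∈ T i} => (r : Fin n)) id).rank = d i) := by
  obtain ⟨f, hf⟩ := Matrix.exists_det_ite_ne_zero (fun j => (e.symm j).1) _ hdet
  have hcols := Matrix.linearIndependent_cols_of_det_ne_zero hf
  let T : Fin c → Finset (Fin n) := fun i => Finset.univ.filter fun r => f r = i
  have hrank : ∀ i,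
      ((U i).submatrix (fun r : {x : Fin n // x ∈ T i} => (r : Fin n)) id).rank = d i := by
    intro i
    have h := Matrix.rank_submatrix_of_linearIndependent_ite (T i) (U i) (by
      have hinj : Function.Injective fun k : Fin (d i) => e ⟨i, k⟩ := fun k k' hk => by
        simpa using hk
      suffices heq : (fun (k : Fin (d i)) (r : Fin n) => if r ∈ T i then U i r k else 0) =
          fun k r => if (e.symm (e ⟨i, k⟩)).1 = f r then
            U (e.symm (e ⟨i, k⟩)).1 r (e.symm (e ⟨i, k⟩)).2 else 0 by
        rw [heq]
        exact hcols.comp _ hinj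
      funext k r
      rw [e.symm_apply_apply]
      simp [T, eq_comm])
    simpa using h
  have hle : ∀ i, d i ≤ (T i).card := fun i => by
    rw [← hrank i]
    simpa using Matrix.rank_le_card_height
      ((U i).submatrix (fun r : {x : Fin n // x ∈ T i} => (r : Fin n)) id)
  have hcard : ∑ i, (T i).card = n := by
    simpa using (Finset.card_eq_sum_card_fiberwise
      (f := f) (s := Finset.univ) (t := Finset.univ) (by simp)).symm
  refine ⟨T, fun i j hij => ?_, fun v => ⟨f v, by simp [T]⟩, fun i => ?_, hrank⟩
  · refine Finset.disjoint_left.2 fun r hi hj => hij ?_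
    simp only [T, Finset.mem_filter_univ] at hi hj
    exact hi.symm.trans hj
  · exact ((Finset.sum_eq_sum_iff_of_le fun i _ => hle i).1 (hsum.trans hcard.symm) i
      (Finset.mem_univ i)).symm
end

section
/- Let F be a field, let ℬ ≤ M(s×t, F) be a matrix space, and let 𝒜 ≤ Λ(s+t, F) be the alternating matrix space consisting of all block matrices [[0, B], [−Bᵀ, 0]] with B ∈ ℬ (the upper-left zero block of size s×s). Then α(𝒜) = (s+t) − ncrk(ℬ). -/
open Matrix

/-- The dimension of a subspace of a product is the sum of the dimensions of its projection to the
first factor and of its intersection with the second factor. -/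
theorem Submodule.finrank_map_fst_add_finrank_comap_inr {F M N : Type*} [Field F]
    [AddCommGroup M] [Module F M] [AddCommGroup N] [Module F N]
    [FiniteDimensional F M] [FiniteDimensional F N] (U : Submodule F (M × N)) :
    Module.finrank F (U.map (LinearMap.fst F M N)) +
      Module.finrank F (U.comap (LinearMap.inr F M N)) = Module.finrank F U := by
  have h := LinearMap.finrank_range_add_finrank_ker ((LinearMap.fst F M N).domRestrict U)
  rw [LinearMap.range_domRestrict, LinearMap.ker_domRestrict] at h
  rw [← h, ((U.comap (LinearMap.inr F M N)).equivMapOfInjective (LinearMap.inr F M N)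
    LinearMap.inr_injective).finrank_eq, Submodule.map_comap_eq, LinearMap.range_inr,
    ← Submodule.finrank_map_subtype_eq U, Submodule.map_comap_subtype, inf_comm]

theorem Matrix.dotProduct_fromBlocks_neg_transpose_mulVec {F m n : Type*} [CommRing F]
    [Fintype m] [Fintype n] (B : Matrix m n F) (u u' : m ⊕ n → F) :
    u ⬝ᵥ fromBlocks 0 B (-Bᵀ) 0 *ᵥ u' =
      (u ∘ Sum.inl) ⬝ᵥ B *ᵥ (u' ∘ Sum.inr) - (u' ∘ Sum.inl) ⬝ᵥ B *ᵥ (u ∘ Sum.inr) := by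
  rw [fromBlocks_mulVec, ← Sum.elim_comp_inl_inr u, sumElim_dotProduct_sumElim]
  simp only [Sum.elim_comp_inl, Sum.elim_comp_inr, zero_mulVec, zero_add, add_zero, neg_mulVec,
    dotProduct_neg, mulVec_transpose, ← sub_eq_add_neg]
  rw [dotProduct_mulVec (u' ∘ Sum.inl), dotProduct_comm (u ∘ Sum.inr)]

/-- The bipartite alternating matrix space of `ℬ` has an isotropic space of dimension `d` iff `ℬ`
has an isotropic pair of total dimension `d`. -/
theorem exists_isotropic_space_iff_exists_isotropic_pair {F m n : Type*} [Field F]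
    [Fintype m] [Fintype n] (ℬ : Submodule F (Matrix m n F)) (d : ℕ) :
    (∃ U : Submodule F (m ⊕ n → F),
      (∀ u ∈ U, ∀ u' ∈ U, ∀ B ∈ ℬ, u ⬝ᵥ fromBlocks 0 B (-Bᵀ) 0 *ᵥ u' = 0) ∧
        Module.finrank F U = d) ↔
    ∃ (V : Submodule F (m → F)) (W : Submodule F (n → F)),
      (∀ v ∈ V, ∀ w ∈ W, ∀ B ∈ ℬ, v ⬝ᵥ B *ᵥ w = 0) ∧
        Module.finrank F V + Module.finrank F W = d := by
  let e := LinearEquiv.sumArrowLequivProdArrow m n F F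
  constructor
  · rintro ⟨U, hU, rfl⟩
    refine ⟨(U.map e.toLinearMap).map (LinearMap.fst F _ _),
      (U.map e.toLinearMap).comap (LinearMap.inr F _ _), ?_, ?_⟩
    · rintro _ ⟨_, ⟨u, hu, rfl⟩, rfl⟩ w ⟨u', hu', hw⟩ B hB
      have h := hU u hu u' hu' B hB
      have h₁ : u' ∘ Sum.inl = 0 := congrArg Prod.fst hw
      have h₂ : u' ∘ Sum.inr = w := congrArg Prod.snd hw
      rw [dotProduct_fromBlocks_neg_transpose_mulVec, h₁, h₂, zero_dotProduct, sub_zero] at h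
      exact h
    · rw [Submodule.finrank_map_fst_add_finrank_comap_inr]
      exact LinearEquiv.finrank_map_eq e U
  · rintro ⟨V, W, hVW, rfl⟩
    refine ⟨(V.prod W).map e.symm.toLinearMap, ?_, ?_⟩
    · rintro _ ⟨p, ⟨hp₁, hp₂⟩, rfl⟩ _ ⟨q, ⟨hq₁, hq₂⟩, rfl⟩ B hB
      rw [dotProduct_fromBlocks_neg_transpose_mulVec]
      exact sub_eq_zero.mpr ((hVW _ hp₁ _ hq₂ B hB).trans (hVW _ hq₁ _ hp₂ B hB).symm)
    · refine (LinearEquiv.finrank_map_eq e.symm _).trans ?_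
      rw [← Submodule.finrank_map_fst_add_finrank_comap_inr, Submodule.prod_map_fst,
        Submodule.prod_comap_inr]

/-- For a matrix space `ℬ ≤ M(s×t, F)` and the bipartite alternating matrix space
`𝒜 = {[[0, B], [−Bᵀ, 0]] : B ∈ ℬ} ≤ Λ(s+t, F)`, the isotropic number of `𝒜` equals
`(s+t) − ncrk(ℬ)`. -/
theorem stmt_6 (F : Type) [Field F] (s t : ℕ)
    (ℬ : Submodule F (Matrix (Fin s) (Fin t) F))
    (𝒜 : Submodule F (Matrix (Fin s ⊕ Fin t) (Fin s ⊕ Fin t) F))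
    (h𝒜 : ∀ M, M ∈ 𝒜 ↔ ∃ B ∈ ℬ, M = Matrix.fromBlocks 0 B (-Bᵀ) 0) :
    sSup {d : ℕ | ∃ U : Submodule F ((Fin s ⊕ Fin t) → F),
        (∀ u ∈ U, ∀ u' ∈ U, ∀ A ∈ 𝒜, u ⬝ᵥ A *ᵥ u' = 0) ∧ Module.finrank F U = d}
      = (s + t) -
        ((s + t) - sSup {k : ℕ | ∃ (V : Submodule F (Fin s → F)) (W : Submodule F (Fin t → F)),
          (∀ v ∈ V, ∀ w ∈ W, ∀ B ∈ ℬ, v ⬝ᵥ B *ᵥ w = 0) ∧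
          Module.finrank F V + Module.finrank F W = k}) := by
  have h_iff (U : Submodule F ((Fin s ⊕ Fin t) → F)) :
      (∀ u ∈ U, ∀ u' ∈ U, ∀ A ∈ 𝒜, u ⬝ᵥ A *ᵥ u' = 0) ↔
        ∀ u ∈ U, ∀ u' ∈ U, ∀ B ∈ ℬ, u ⬝ᵥ fromBlocks 0 B (-Bᵀ) 0 *ᵥ u' = 0 := by
    simp only [h𝒜, forall_exists_index, and_imp]
    exact ⟨fun h u hu u' hu' B hB => h u hu u' hu' _ B hB rfl,
      fun h u hu u' hu' A B hB hA => hA ▸ h u hu u' hu' B hB⟩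
  simp only [h_iff, exists_isotropic_space_iff_exists_isotropic_pair]
  refine (Nat.sub_sub_self (csSup_le' ?_)).symm
  rintro _ ⟨V, W, -, rfl⟩
  simpa using add_le_add V.finrank_le W.finrank_le
end

section
/- Let q be a prime power, n even, and A ∈ Λ(n, F_q) a non-degenerate alternating matrix. Then for every d with 0 ≤ d ≤ n/2, the number I(A,d) of d-dimensional isotropic spaces of A satisfies q^{nd − d(3d−1)/2} ≤ I(A,d) ≤ q^{nd − 3d(d−1)/2} (equivalently, q^{nd − (3/2)d² + (1/2)d} ≤ I(A,d) ≤ q^{nd − (3/2)d² + (3/2)d}). -/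
open Matrix

namespace LinearMap.BilinForm

open Module Submodule

section

variable {K V : Type*} [Field K] [AddCommGroup V] [Module K V] {B : LinearMap.BilinForm K V}

/-- Adjoining a vector `v` to an isotropic subspace of an alternating form keeps it isotropic
exactly when `v` is orthogonal to the subspace. -/
theorem IsAlt.span_insert_le_orthogonal_iff (hB : B.IsAlt) (v : V) (s : Set V) :
    span K (insert v s) ≤ B.orthogonal (span K (insert v s)) ↔
      span K s ≤ B.orthogonal (span K s) ∧ v ∈ B.orthogonal (span K s) := by
  constructor
  · intro h
    have hs : span K s ≤ span K (insert v s) := span_mono (Set.subset_insert v s)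
    exact ⟨fun x hx y hy ↦ h (hs hx) y (hs hy),
      fun y hy ↦ h (subset_span (Set.mem_insert v s)) y (hs hy)⟩
  · rintro ⟨h, hv⟩ x hx y hy
    obtain ⟨a, x, hx', rfl⟩ := mem_span_insert.1 hx
    obtain ⟨b, y, hy', rfl⟩ := mem_span_insert.1 hy
    have hyv : B y v = 0 := hv y hy'
    have hvx : B v x = 0 := hB.isRefl x v (hv x hx')
    have hyx : B y x = 0 := h hx' y hy'
    have hvv : B v v = 0 := hB v
    simp [hyv, hvx, hyx, hvv]

variable (B) in
/-- The linearly independent `k`-tuples of vectors that span an isotropic subspace. -/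
abbrev IsotropicFrame (k : ℕ) : Type _ :=
  {s : Fin k → V // LinearIndependent K s ∧
    span K (Set.range s) ≤ B.orthogonal (span K (Set.range s))}

variable (B) in
/-- The isotropic subspaces of dimension `k`. -/
abbrev IsotropicSubspace (k : ℕ) : Type _ :=
  {U : Submodule K V // U ≤ B.orthogonal U ∧ finrank K U = k}

/-- An isotropic frame of length `k + 1` is an isotropic frame of length `k` together with a vector
orthogonal to its span, but not in it. -/
def IsAlt.isotropicFrameSuccEquiv (hB : B.IsAlt) (k : ℕ) :
    B.IsotropicFrame (k + 1) ≃ Σ s : B.IsotropicFrame k,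
      ↥((B.orthogonal (span K (Set.range s.1)) : Set V) \ span K (Set.range s.1)) where
  toFun s :=
    have h : LinearIndependent K (Fin.cons (s.1 0) (Fin.tail s.1) : Fin (k + 1) → V) ∧
        span K (Set.range (Fin.cons (s.1 0) (Fin.tail s.1) : Fin (k + 1) → V)) ≤
          B.orthogonal (span K (Set.range (Fin.cons (s.1 0) (Fin.tail s.1) : Fin (k + 1) → V))) := by
      rw [Fin.cons_self_tail]; exact s.2
    have h' := (hB.span_insert_le_orthogonal_iff _ _).1 (Fin.range_cons (s.1 0) _ ▸ h.2)
    ⟨⟨Fin.tail s.1, (linearIndependent_finCons.1 h.1).1, h'.1⟩,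
      ⟨s.1 0, h'.2, (linearIndependent_finCons.1 h.1).2⟩⟩
  invFun p := ⟨Fin.cons p.2.1 p.1.1, linearIndependent_finCons.2 ⟨p.1.2.1, p.2.2.2⟩, by
    rw [Fin.range_cons]
    exact (hB.span_insert_le_orthogonal_iff _ _).2 ⟨p.1.2.2, p.2.2.1⟩⟩
  left_inv s := Subtype.ext (Fin.cons_self_tail s.1)
  right_inv _ := rfl

/-- An isotropic frame of length `k` is an isotropic subspace of dimension `k` together with
a linearly independent `k`-tuple in it. -/
def isotropicFrameEquiv [FiniteDimensional K V] (k : ℕ) :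
    B.IsotropicFrame k ≃
      Σ U : B.IsotropicSubspace k, {s : Fin k → U.1 // LinearIndependent K s} where
  toFun s := ⟨⟨span K (Set.range s.1), s.2.2, by simpa using finrank_span_eq_card s.2.1⟩,
    fun i ↦ ⟨s.1 i, subset_span (Set.mem_range_self i)⟩,
    linearIndependent_span s.2.1⟩
  invFun p := ⟨fun i ↦ (p.2.1 i : V), p.2.2.map' p.1.1.subtype p.1.1.ker_subtype, by
    have h : span K (Set.range fun i ↦ (p.2.1 i : V)) ≤ p.1.1 :=
      span_le.2 (Set.range_subset_iff.2 fun i ↦ (p.2.1 i).2)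
    exact fun x hx y hy ↦ p.1.2.1 (h hx) y (h hy)⟩
  left_inv _ := rfl
  right_inv := by
    rintro ⟨⟨U, hU, hk⟩, s, hs⟩
    obtain ⟨t, ht, rfl⟩ : ∃ (t : Fin k → V) (ht : ∀ i, t i ∈ U), s = fun i ↦ ⟨t i, ht i⟩ :=
      ⟨fun i ↦ s i, fun i ↦ (s i).2, rfl⟩
    have hs' : LinearIndependent K t := hs.map' U.subtype U.ker_subtype
    have h : span K (Set.range t) = U :=
      eq_of_le_of_finrank_eq (span_le.2 (Set.range_subset_iff.2 ht))
        (by rw [finrank_span_eq_card hs', hk, Fintype.card_fin])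
    subst h
    rfl

variable [Fintype K] [Finite V]

/-- The number of isotropic frames of a nondegenerate alternating form. -/
theorem IsAlt.card_isotropicFrame (hB : B.IsAlt) (hnd : B.Nondegenerate) (k : ℕ) :
    Nat.card (B.IsotropicFrame k) =
      ∏ i ∈ Finset.range k, (Fintype.card K ^ (finrank K V - i) - Fintype.card K ^ i) := by
  induction k with
  | zero =>
    rw [Finset.prod_range_zero, Nat.card_eq_one_iff_unique]
    refine ⟨⟨fun _ _ ↦ Subtype.ext (Subsingleton.elim _ _)⟩, ⟨0, linearIndependent_empty_type, ?_⟩⟩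
    simp [Set.range_eq_empty]
  | succ k ih =>
    have hfib (s : B.IsotropicFrame k) :
        Nat.card ↥((B.orthogonal (span K (Set.range s.1)) : Set V) \ span K (Set.range s.1)) =
          Fintype.card K ^ (finrank K V - k) - Fintype.card K ^ k := by
      have hs : finrank K (span K (Set.range s.1)) = k := by
        simpa using finrank_span_eq_card s.2.1
      rw [Nat.card_coe_set_eq, Set.ncard_sdiff s.2.2, ← Nat.card_coe_set_eq, ← Nat.card_coe_set_eq,
        SetLike.coe_sort_coe, SetLike.coe_sort_coe, Module.natCard_eq_pow_finrank (K := K),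
        Module.natCard_eq_pow_finrank (K := K) (V := span K _), finrank_orthogonal hnd, hs,
        Nat.card_eq_fintype_card]
    have := Fintype.ofFinite (B.IsotropicFrame k)
    rw [Nat.card_congr (hB.isotropicFrameSuccEquiv k), Nat.card_sigma, Finset.sum_congr rfl
      fun s _ ↦ hfib s, Finset.sum_const, Finset.card_univ, ← Nat.card_eq_fintype_card, ih,
      Finset.prod_range_succ, smul_eq_mul]

/-- The number of isotropic subspaces of a nondegenerate alternating form, multiplied by the number
of bases of each of them. -/
theorem IsAlt.card_isotropicSubspace_mul (hB : B.IsAlt) (hnd : B.Nondegenerate) (k : ℕ) :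
    Nat.card (B.IsotropicSubspace k) *
        ∏ i ∈ Finset.range k, (Fintype.card K ^ k - Fintype.card K ^ i) =
      ∏ i ∈ Finset.range k, (Fintype.card K ^ (finrank K V - i) - Fintype.card K ^ i) := by
  have hfib (U : B.IsotropicSubspace k) :
      Nat.card {s : Fin k → U.1 // LinearIndependent K s} =
        ∏ i ∈ Finset.range k, (Fintype.card K ^ k - Fintype.card K ^ i) := by
    rw [card_linearIndependent U.2.2.ge, U.2.2,
      Finset.prod_range fun i ↦ Fintype.card K ^ k - Fintype.card K ^ i]
  have := Fintype.ofFinite (B.IsotropicSubspace k)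
  rw [← hB.card_isotropicFrame hnd, Nat.card_congr (isotropicFrameEquiv k), Nat.card_sigma,
    Finset.sum_congr rfl fun U _ ↦ hfib U, Finset.sum_const, Finset.card_univ,
    Nat.card_eq_fintype_card, smul_eq_mul]

end

end LinearMap.BilinForm

theorem Matrix.det_ne_zero_of_rank_eq {F : Type*} [Field F] {n : ℕ} {A : Matrix (Fin n) (Fin n) F}
    (h : A.rank = n) : A.det ≠ 0 := by
  rw [← isUnit_iff_ne_zero, ← A.isUnit_iff_isUnit_det, ← linearIndependent_cols_iff_isUnit,
    linearIndependent_iff_card_eq_finrank_span, Set.finrank, ← rank_eq_finrank_span_cols, h,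
    Fintype.card_fin]

theorem pow_sub_pow_mul_pow_le {q n d i : ℕ} (hq : 1 < q) (hd : 2 * d ≤ n) (hi : i < d) :
    q ^ (n - d - i) * (q ^ d - q ^ i) ≤ q ^ (n - i) - q ^ i := by
  rw [Nat.mul_sub, ← pow_add, ← pow_add, show n - d - i + d = n - i by lia,
    show n - d - i + i = n - d by lia]
  exact Nat.sub_le_sub_left (Nat.pow_le_pow_right hq.le (by lia)) _

theorem pow_sub_pow_le_mul {q n d i : ℕ} (hq : 1 < q) (hd : 2 * d ≤ n) (hi : i < d) :
    q ^ (n - i) - q ^ i ≤ q ^ (n - d - i + 1) * (q ^ d - q ^ i) := by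
  rw [Nat.mul_sub, ← pow_add, ← pow_add, show n - d - i + 1 + d = n - i + 1 by lia,
    show n - d - i + 1 + i = n - d + 1 by lia]
  have h1 : q ^ (n - d + 1) ≤ q ^ (n - i) := Nat.pow_le_pow_right hq.le (by lia)
  have h2 : 2 * q ^ (n - i) ≤ q ^ (n - i + 1) := by rw [pow_succ']; gcongr; exact hq
  lia

theorem sum_range_sub_sub {n d : ℕ} (hd : 2 * d ≤ n) :
    ∑ i ∈ Finset.range d, (n - d - i) = n * d - d * (3 * d - 1) / 2 := by
  have h : ∀ k ≤ d, 2 * ∑ i ∈ Finset.range k, ((n - d - i : ℕ) : ℤ) =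
      2 * (n - d) * k - k * (k - 1) := by
    intro k hk
    induction k with
    | zero => simp
    | succ k ih =>
      rw [Finset.sum_range_succ, mul_add, ih (by lia), Nat.sub_sub, Nat.cast_sub (by lia)]
      push_cast
      ring
  have := h d le_rfl
  rw [← Nat.cast_sum] at this
  generalize ∑ i ∈ Finset.range d, (n - d - i) = S at *
  have h3 : 2 * S + d * (3 * d - 1) = 2 * (n * d) := by
    rcases d with _ | d
    · simp_all
    · zify
      rw [Nat.cast_sub (by lia), this]
      push_cast
      ring
  generalize n * d = x at *
  generalize d * (3 * d - 1) = y at *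
  lia

theorem sum_range_sub_sub_add_one {n d : ℕ} (hd : 2 * d ≤ n) :
    ∑ i ∈ Finset.range d, (n - d - i + 1) = n * d - 3 * d * (d - 1) / 2 := by
  rw [Finset.sum_add_distrib, sum_range_sub_sub hd, Finset.sum_const, Finset.card_range,
    smul_eq_mul, mul_one]
  rcases d with _ | d
  · simp
  have h1 : (d + 1) * (3 * (d + 1) - 1) = 3 * (d + 1) * (d + 1 - 1) + 2 * (d + 1) := by
    rw [show 3 * (d + 1) - 1 = 3 * d + 2 by lia, Nat.add_sub_cancel]
    ring
  have h2 : 2 * (d + 1) * (d + 1) ≤ n * (d + 1) := Nat.mul_le_mul_right _ hd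
  have h3 : 3 * (d + 1) * (d + 1 - 1) + 2 * (d + 1) ≤ 2 * (2 * (d + 1) * (d + 1)) := by
    rw [Nat.add_sub_cancel]
    nlinarith
  rw [h1]
  generalize n * (d + 1) = x at *
  generalize 3 * (d + 1) * (d + 1 - 1) = y at *
  lia

/-- Let `A ∈ Λ(n, F_q)` be non-degenerate (`rank A = n`, `n` even). For every
`d` with `0 ≤ d ≤ n/2`, the number `I(A,d)` of `d`-dimensional isotropic spaces of `A`
satisfies `q^{nd − d(3d−1)/2} ≤ I(A,d) ≤ q^{nd − 3d(d−1)/2}`. -/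
theorem stmt_10 (F : Type) [Field F] [Fintype F] (n : ℕ) (hn : Even n)
    (A : Matrix (Fin n) (Fin n) F)
    (halt : ∀ v : Fin n → F, v ⬝ᵥ A *ᵥ v = 0)
    (hrank : A.rank = n) :
    ∀ d : ℕ, 2 * d ≤ n →
      Fintype.card F ^ (n * d - d * (3 * d - 1) / 2)
        ≤ Nat.card {U : Submodule F (Fin n → F) //
            (∀ u ∈ U, ∀ u' ∈ U, u ⬝ᵥ A *ᵥ u' = 0) ∧ Module.finrank F U = d}
      ∧ Nat.card {U : Submodule F (Fin n → F) //
            (∀ u ∈ U, ∀ u' ∈ U, u ⬝ᵥ A *ᵥ u' = 0) ∧ Module.finrank F U = d}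
          ≤ Fintype.card F ^ (n * d - 3 * d * (d - 1) / 2) := by
  intro d hd
  have hB : (Matrix.toBilin' A).IsAlt := fun v ↦ by rw [Matrix.toBilin'_apply', halt]
  have hnd : (Matrix.toBilin' A).Nondegenerate :=
    LinearMap.BilinForm.nondegenerate_toBilin'_of_det_ne_zero' A (det_ne_zero_of_rank_eq hrank)
  have hcard : Nat.card {U : Submodule F (Fin n → F) //
      (∀ u ∈ U, ∀ u' ∈ U, u ⬝ᵥ A *ᵥ u' = 0) ∧ Module.finrank F U = d} =
      Nat.card ((Matrix.toBilin' A).IsotropicSubspace d) := by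
    refine Nat.card_congr (Equiv.subtypeEquivRight fun U ↦ and_congr_left' ?_)
    simp only [← Matrix.toBilin'_apply']
    exact ⟨fun h u hu u' hu' ↦ h u' hu' u hu, fun h u hu u' hu' ↦ h hu' u hu⟩
  have hmul := hB.card_isotropicSubspace_mul hnd d
  rw [Module.finrank_fin_fun] at hmul
  have hq : 1 < Fintype.card F := Fintype.one_lt_card
  have hpos : 0 < ∏ i ∈ Finset.range d, (Fintype.card F ^ d - Fintype.card F ^ i) :=
    Finset.prod_pos fun i hi ↦
      Nat.sub_pos_of_lt (Nat.pow_lt_pow_right hq (Finset.mem_range.1 hi))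
  rw [hcard, ← sum_range_sub_sub hd, ← sum_range_sub_sub_add_one hd, ← Finset.prod_pow_eq_pow_sum,
    ← Finset.prod_pow_eq_pow_sum]
  constructor
  · refine Nat.le_of_mul_le_mul_right ?_ hpos
    rw [hmul, ← Finset.prod_mul_distrib]
    exact Finset.prod_le_prod' fun i hi ↦ pow_sub_pow_mul_pow_le hq hd (Finset.mem_range.1 hi)
  · refine Nat.le_of_mul_le_mul_right ?_ hpos
    rw [hmul, ← Finset.prod_mul_distrib]
    exact Finset.prod_le_prod' fun i hi ↦ pow_sub_pow_le_mul hq hd (Finset.mem_range.1 hi)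
end

section
/- There exists an absolute constant C such that for every prime power q, every n ≥ 1, and every alternating matrix space 𝒜 ≤ Λ(n, F_q), the number of maximal isotropic spaces of 𝒜 is at most q^{n²/6 + C·n} (as real numbers). -/
open Matrix

section SelfOrthogonal

open Module

variable {F V W : Type*} [Field F] [AddCommGroup V] [Module F V] [AddCommGroup W] [Module F W]

/-- The subspaces of `T` that coincide with their orthogonal in `T` with respect to the bilinear
map `B`. For alternating `B` these are the maximal isotropic subspaces of `T`. -/
def selfOrthogonal (B : V →ₗ[F] V →ₗ[F] W) (T : Submodule F V) : Set (Submodule F V) :=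
  {U | U ≤ T ∧ ∀ v ∈ T, v ∈ U ↔ ∀ u ∈ U, B u v = 0}

theorem selfOrthogonal_subset_of_le {B : V →ₗ[F] V →ₗ[F] W} {R T U : Submodule F V} (hRT : R ≤ T)
    (hUR : U ≤ R) (hU : U ∈ selfOrthogonal B T) : U ∈ selfOrthogonal B R :=
  ⟨hUR, fun v hv ↦ hU.2 v (hRT hv)⟩

theorem finrank_inf_ker_add_finrank_map [FiniteDimensional F V] (f : V →ₗ[F] W)
    (T : Submodule F V) :
    finrank F (T ⊓ LinearMap.ker f : Submodule F V) + finrank F (T.map f) = finrank F T := by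
  have h := (f.domRestrict T).finrank_range_add_finrank_ker
  have h1 : LinearMap.range (f.domRestrict T) = T.map f := by
    rw [LinearMap.range_domRestrict]
  have h2 : finrank F (LinearMap.ker (f.domRestrict T)) =
      finrank F (T ⊓ LinearMap.ker f : Submodule F V) := by
    rw [← Submodule.finrank_map_subtype_eq T]
    have : (LinearMap.ker (f.domRestrict T)).map T.subtype = T ⊓ LinearMap.ker f := by
      ext x
      simp [and_comm]
    rw [this]
  rw [h1, h2] at h
  omega

theorem mem_span_singleton_of_finrank_map_le_one [FiniteDimensional F V] {f : V →ₗ[F] W}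
    {T : Submodule F V} (h : finrank F (T.map f) ≤ 1) {x y : V} (hx : x ∈ T) (hy : y ∈ T)
    (hfx : f x ≠ 0) : f y ∈ Submodule.span F {f x} := by
  have hle : Submodule.span F {f x} ≤ T.map f := by
    rw [Submodule.span_singleton_le_iff_mem]
    exact Submodule.mem_map_of_mem hx
  have heq := Submodule.eq_of_le_of_finrank_le hle (by rw [finrank_span_singleton hfx]; exact h)
  rw [heq]
  exact Submodule.mem_map_of_mem hy

theorem mem_span_singleton_of_apply_eq_zero [FiniteDimensional F V] {B : V →ₗ[F] V →ₗ[F] W}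
    {T U : Submodule F V} (hU : ∀ u ∈ U, finrank F (T.map (B u)) ≤ 1) {a b v x : V} (ha : a ∈ U)
    (hb : b ∈ U) (hv : v ∈ T) (hx : x ∈ T) (hav : B a v = 0) (hbv : B b v ≠ 0) :
    B a x ∈ Submodule.span F {B b v} := by
  have h1 := mem_span_singleton_of_finrank_map_le_one (hU b hb) hv hx hbv
  have h2 := mem_span_singleton_of_finrank_map_le_one (hU _ (U.add_mem ha hb)) hv hx
    (by simpa [hav] using hbv)
  simp only [map_add, LinearMap.add_apply, hav, zero_add] at h2
  simpa using Submodule.sub_mem _ h2 h1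

/-- If all the maps `B u`, `u ∈ U`, have rank at most one on `T`, then they have a common kernel
or a common image. -/
theorem eq_inf_ker_or_apply_mem_map [FiniteDimensional F V] {B : V →ₗ[F] V →ₗ[F] W}
    {T U : Submodule F V} (hUT : U ∈ selfOrthogonal B T)
    (hU : ∀ u ∈ U, finrank F (T.map (B u)) ≤ 1) :
    (∃ u ∈ U, U = T ⊓ LinearMap.ker (B u)) ∨
      ∃ u ∈ U, ∀ u' ∈ U, ∀ v ∈ T, B u' v ∈ T.map (B u) := by
  by_cases h0 : ∀ u ∈ U, ∀ v ∈ T, B u v = 0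
  · exact .inr ⟨0, U.zero_mem, fun u hu v hv ↦ by simp [h0 u hu v hv]⟩
  push Not at h0
  obtain ⟨u, hu, v₀, hv₀, hl⟩ := h0
  by_cases h1 : ∀ u' ∈ U, ∀ v ∈ T, B u' v ∈ T.map (B u)
  · exact .inr ⟨u, hu, h1⟩
  push Not at h1
  obtain ⟨u', hu', v₁, hv₁, hl'⟩ := h1
  have hspan : T.map (B u) = Submodule.span F {B u v₀} := by
    refine le_antisymm ?_ ?_
    · rintro _ ⟨y, hy, rfl⟩
      exact mem_span_singleton_of_finrank_map_le_one (hU u hu) hv₀ hy hl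
    · rw [Submodule.span_singleton_le_iff_mem]
      exact Submodule.mem_map_of_mem hv₀
  rw [hspan] at hl'
  have key : ∀ w : W, B u v₀ ∈ Submodule.span F {w} → B u' v₁ ∉ Submodule.span F {w} := by
    intro w hw hw'
    obtain ⟨c, hc⟩ := Submodule.mem_span_singleton.1 hw
    have hc0 : c ≠ 0 := by
      rintro rfl
      exact hl (by simpa using hc.symm)
    apply hl'
    rw [← hc]
    rwa [Submodule.span_singleton_smul_eq (IsUnit.mk0 c hc0)]
  refine .inl ⟨u, hu, le_antisymm
    (fun v hv ↦ ⟨hUT.1 hv, (hUT.2 v (hUT.1 hv)).1 hv u hu⟩) ?_⟩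
  rintro v ⟨hvT, hv⟩
  have hv : B u v = 0 := hv
  have hv' : B u' v = 0 := by
    by_contra hne
    exact key _ (mem_span_singleton_of_apply_eq_zero hU hu hu' hvT hv₀ hv hne)
      (mem_span_singleton_of_finrank_map_le_one (hU u' hu') hvT hv₁ hne)
  refine (hUT.2 v hvT).2 fun b hb ↦ ?_
  by_contra hne
  exact key _ (mem_span_singleton_of_apply_eq_zero hU hu hb hvT hv₀ hv hne)
    (mem_span_singleton_of_apply_eq_zero hU hu' hb hvT hv₁ hv' hne)

theorem ncard_le_ncard_mul_of_forall_exists {α β : Type*} [Finite α] [Finite β] {S : Set α}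
    {D : Set β} (A : β → Set α) {k : ℝ} (h : ∀ x ∈ S, ∃ d ∈ D, x ∈ A d)
    (hk : ∀ d ∈ D, ((A d).ncard : ℝ) ≤ k) : (S.ncard : ℝ) ≤ D.ncard * k := by
  have hD := D.toFinite
  have hsub : S ⊆ ⋃ d ∈ hD.toFinset, A d := by
    intro x hx
    obtain ⟨d, hd, hxd⟩ := h x hx
    simp only [Set.mem_iUnion]
    exact ⟨d, by simpa using hd, hxd⟩
  have h1 : S.ncard ≤ ∑ d ∈ hD.toFinset, (A d).ncard :=
    (Set.ncard_le_ncard hsub).trans (hD.toFinset.set_ncard_biUnion_le A)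
  calc (S.ncard : ℝ) ≤ ∑ d ∈ hD.toFinset, ((A d).ncard : ℝ) := by exact_mod_cast h1
    _ ≤ hD.toFinset.card • k := Finset.sum_le_card_nsmul _ _ _ fun d hd ↦ hk d (by simpa using hd)
    _ = D.ncard * k := by rw [Set.ncard_eq_toFinset_card D hD, nsmul_eq_mul]

theorem Submodule.ncard_eq_card_pow_finrank [Fintype F] [FiniteDimensional F V]
    (D : Submodule F V) : ((D : Set V).ncard : ℝ) = (Fintype.card F : ℝ) ^ (finrank F D : ℝ) := by
  have h := Module.natCard_eq_pow_finrank (K := F) (V := D)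
  rw [Nat.card_eq_fintype_card (α := F)] at h
  rw [Real.rpow_natCast]
  exact_mod_cast h

theorem Submodule.exists_le_finrank_eq {R : Submodule F V} {k : ℕ} (hk : k ≤ finrank F R) :
    ∃ D ≤ R, finrank F D = k := by
  obtain ⟨s, hs, hli⟩ := exists_finset_linearIndependent_of_le_finrank hk
  refine ⟨(Submodule.span F (s : Set R)).map R.subtype, Submodule.map_subtype_le _ _, ?_⟩
  rw [Submodule.finrank_map_subtype_eq, finrank_span_finset_eq_card hli, hs]

variable [Finite V]

/-- Passing to `u^⊥ / ⟨u⟩`, realised as a complement of `⟨u⟩` in `T ⊓ ker (B u)`. -/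
theorem exists_ncard_selfOrthogonal_le {B : V →ₗ[F] V →ₗ[F] W} (hB : ∀ v, B v v = 0)
    {T : Submodule F V} {u : V} (huT : u ∈ T) (hu : u ≠ 0) :
    ∃ T' ≤ T, finrank F T' + 1 = finrank F (T ⊓ LinearMap.ker (B u) : Submodule F V) ∧
      {U ∈ selfOrthogonal B T | u ∈ U}.ncard ≤ (selfOrthogonal B T').ncard := by
  have : Module.Finite F V := Module.Finite.of_finite
  obtain ⟨Q, hQ⟩ := (Submodule.span F {u}).exists_isCompl
  set K := T ⊓ LinearMap.ker (B u) with hK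
  have huK : Submodule.span F {u} ≤ K := by
    rw [Submodule.span_singleton_le_iff_mem]
    exact ⟨huT, hB u⟩
  have hsplit : ∀ X : Submodule F V, Submodule.span F {u} ≤ X →
      Submodule.span F {u} ⊔ Q ⊓ X = X := by
    intro X hX
    rw [← sup_inf_assoc_of_le Q hX, hQ.sup_eq_top, top_inf_eq]
  have hUK : ∀ U ∈ selfOrthogonal B T, u ∈ U → U ≤ K := fun U hU huU v hv ↦
    ⟨hU.1 hv, (hU.2 v (hU.1 hv)).1 hv u huU⟩
  refine ⟨Q ⊓ K, inf_le_right.trans inf_le_left, ?_, ?_⟩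
  · have h := Submodule.finrank_sup_add_finrank_inf_eq (Submodule.span F {u}) (Q ⊓ K)
    rw [hsplit K huK, finrank_span_singleton hu, ← inf_assoc, hQ.inf_eq_bot, bot_inf_eq,
      finrank_bot] at h
    omega
  · refine Set.ncard_le_ncard_of_injOn (fun U ↦ Q ⊓ U) ?_ ?_
    · rintro U ⟨hU, huU⟩
      refine ⟨inf_le_inf_left Q (hUK U hU huU), fun v hv ↦ ⟨fun hvU u' hu' ↦
        (hU.2 v hv.2.1).1 hvU.2 u' hu'.2, fun h ↦ ⟨hv.1, (hU.2 v hv.2.1).2 fun w hw ↦ ?_⟩⟩⟩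
      rw [← hsplit U (by rwa [Submodule.span_singleton_le_iff_mem])] at hw
      obtain ⟨x, hx, y, hy, rfl⟩ := Submodule.mem_sup.1 hw
      obtain ⟨c, rfl⟩ := Submodule.mem_span_singleton.1 hx
      have h1 : B u v = 0 := hv.2.2
      simp [h1, h y hy]
    · rintro U ⟨hU, huU⟩ U' ⟨hU', huU'⟩ h
      rw [← hsplit U (by rwa [Submodule.span_singleton_le_iff_mem]),
        ← hsplit U' (by rwa [Submodule.span_singleton_le_iff_mem])]
      exact congrArg _ h

theorem finrank_le_two_mul_finrank_of_mem_selfOrthogonal {ω : V →ₗ[F] V →ₗ[F] F}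
    {R U : Submodule F V} (hU : U ∈ selfOrthogonal ω R) : finrank F R ≤ 2 * finrank F U := by
  have : Module.Finite F V := Module.Finite.of_finite
  let f : V →ₗ[F] Dual F U := (ω.domRestrict U).flip
  have h := finrank_inf_ker_add_finrank_map f R
  have h1 : R ⊓ LinearMap.ker f = U := by
    ext v
    refine ⟨fun hv ↦ (hU.2 v hv.1).2 fun u hu ↦ ?_, fun hv ↦ ⟨hU.1 hv, ?_⟩⟩
    · exact LinearMap.congr_fun (show f v = 0 from hv.2) ⟨u, hu⟩
    · exact LinearMap.ext fun u ↦ (hU.2 v (hU.1 hv)).1 hv u u.2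
  have h2 := Submodule.finrank_le (R.map f)
  rw [Subspace.dual_finrank_eq] at h2
  rw [h1] at h
  omega

variable [Fintype F]

theorem ncard_selfOrthogonal_le_of_form {ω : V →ₗ[F] V →ₗ[F] F} (hω : ∀ v, ω v v = 0) :
    ∀ (r : ℕ) (R : Submodule F V), finrank F R = r →
      ((selfOrthogonal ω R).ncard : ℝ) ≤ (Fintype.card F : ℝ) ^ ((r : ℝ) ^ 2 / 8 + r) := by
  have : Module.Finite F V := Module.Finite.of_finite
  have hq : (1 : ℝ) ≤ Fintype.card F := by exact_mod_cast Fintype.card_pos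
  intro r
  induction r using Nat.strong_induction_on with
  | _ r ih =>
  intro R hR
  by_cases hrad : ∃ u ∈ R, u ≠ 0 ∧ ∀ v ∈ R, ω v u = 0
  · obtain ⟨u, huR, hu0, hu⟩ := hrad
    obtain ⟨T', hT'R, hT', hle⟩ := exists_ncard_selfOrthogonal_le hω huR hu0
    have hlt : finrank F T' < r := by
      have := finrank_inf_ker_add_finrank_map (ω u) R
      omega
    have heq : {U ∈ selfOrthogonal ω R | u ∈ U} = selfOrthogonal ω R :=
      Set.sep_eq_self_iff_mem_true.2 fun U hU ↦ (hU.2 u huR).2 fun v hv ↦ hu v (hU.1 hv)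
    rw [heq] at hle
    calc ((selfOrthogonal ω R).ncard : ℝ) ≤ (selfOrthogonal ω T').ncard := by exact_mod_cast hle
      _ ≤ _ := ih _ hlt T' rfl
      _ ≤ _ := by gcongr
  push Not at hrad
  rcases Nat.eq_zero_or_pos r with rfl | hr
  · have hsub : selfOrthogonal ω R ⊆ {⊥} := by
      intro U hU
      rw [Submodule.finrank_eq_zero] at hR
      exact le_bot_iff.1 (hR ▸ hU.1)
    have := Set.ncard_le_ncard hsub
    rw [Set.ncard_singleton] at this
    simpa using this
  obtain ⟨D, hDR, hD⟩ := Submodule.exists_le_finrank_eq (R := R) (k := r / 2 + 1) (by omega)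
  have hcover : ∀ U ∈ selfOrthogonal ω R, ∃ u ∈ (D : Set V) \ {0},
      U ∈ {U ∈ selfOrthogonal ω R | u ∈ U} := by
    intro U hU
    have h1 := finrank_le_two_mul_finrank_of_mem_selfOrthogonal hU
    have h2 := Submodule.finrank_sup_add_finrank_inf_eq D U
    have h3 := Submodule.finrank_mono (sup_le hDR hU.1)
    have h4 : D ⊓ U ≠ ⊥ := by
      intro h
      rw [h, finrank_bot] at h2
      omega
    obtain ⟨u, hu, hu0⟩ := Submodule.exists_mem_ne_zero_of_ne_bot h4
    exact ⟨u, ⟨hu.1, hu0⟩, hU, hu.2⟩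
  have hbound : ∀ u ∈ (D : Set V) \ {0}, ({U ∈ selfOrthogonal ω R | u ∈ U}.ncard : ℝ) ≤
      (Fintype.card F : ℝ) ^ (((r : ℝ) - 2) ^ 2 / 8 + ((r : ℝ) - 2)) := by
    rintro u ⟨huD, hu0⟩
    obtain ⟨T', hT'R, hT', hle⟩ := exists_ncard_selfOrthogonal_le hω (hDR huD) hu0
    have h1 := finrank_inf_ker_add_finrank_map (ω u) R
    have h2 : finrank F (R.map (ω u)) ≤ 1 := by
      simpa using Submodule.finrank_le (R.map (ω u))
    have h3 : 0 < finrank F (R.map (ω u)) := by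
      rw [Nat.pos_iff_ne_zero, Ne, Submodule.finrank_eq_zero]
      intro h
      obtain ⟨v, hv, hvu⟩ := hrad u (hDR huD) hu0
      apply hvu
      have h4 : ω u v = 0 := by
        simpa [h] using Submodule.mem_map_of_mem (f := ω u) hv
      have h5 := hω (u + v)
      simpa [hω, h4] using h5
    have h4 : finrank F T' + 2 = r := by omega
    have h5 : (finrank F T' : ℝ) = (r : ℝ) - 2 := by
      rw [← h4]; push_cast; ring
    have h6 := ih _ (by omega) T' rfl
    rw [h5] at h6
    exact le_trans (by exact_mod_cast hle) h6
  have h1 := ncard_le_ncard_mul_of_forall_exists _ hcover hbound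
  have h2 : ((((D : Set V) \ {0}).ncard : ℕ) : ℝ) ≤ (Fintype.card F : ℝ) ^ ((r : ℝ) / 2 + 1) := by
    calc ((((D : Set V) \ {0}).ncard : ℕ) : ℝ) ≤ (D : Set V).ncard := by
          exact_mod_cast Set.ncard_le_ncard Set.sdiff_subset
      _ = (Fintype.card F : ℝ) ^ (((r / 2 + 1 : ℕ)) : ℝ) := by
          rw [Submodule.ncard_eq_card_pow_finrank, hD]
      _ ≤ _ := by
          gcongr
          push_cast
          gcongr
          exact Nat.cast_div_le
  calc ((selfOrthogonal ω R).ncard : ℝ) ≤ _ := h1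
    _ ≤ (Fintype.card F : ℝ) ^ ((r : ℝ) / 2 + 1) *
        (Fintype.card F : ℝ) ^ (((r : ℝ) - 2) ^ 2 / 8 + ((r : ℝ) - 2)) := by gcongr
    _ = (Fintype.card F : ℝ) ^ (((r : ℝ) / 2 + 1) + (((r : ℝ) - 2) ^ 2 / 8 + ((r : ℝ) - 2))) :=
        (Real.rpow_add (by linarith) _ _).symm
    _ ≤ _ := by
        apply Real.rpow_le_rpow_of_exponent_le hq
        nlinarith

theorem ncard_selfOrthogonal_le_of_finrank_le_one {B : V →ₗ[F] V →ₗ[F] W} (hB : ∀ v, B v v = 0)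
    {R : Submodule F V} {L : Submodule F W} [FiniteDimensional F L] (hL : finrank F L ≤ 1)
    (hR : ∀ v ∈ R, ∀ w ∈ R, B v w ∈ L) :
    ((selfOrthogonal B R).ncard : ℝ) ≤
      (Fintype.card F : ℝ) ^ ((finrank F R : ℝ) ^ 2 / 8 + finrank F R) := by
  obtain ⟨f, hf⟩ : ∃ f : W →ₗ[F] F, ∀ w ∈ L, f w = 0 ↔ w = 0 := by
    obtain ⟨g, hg⟩ := (finrank_le_iff_exists_linearMap (R := F) (M := L) (M' := F)).1
      (by simpa using hL)
    obtain ⟨f, hf⟩ := g.exists_extend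
    refine ⟨f, fun w hw ↦ ⟨fun h ↦ ?_, fun h ↦ by simp [h]⟩⟩
    have h1 : g ⟨w, hw⟩ = 0 := by rw [← hf]; exact h
    exact congrArg Subtype.val ((map_eq_zero_iff g hg).1 h1)
  have heq : selfOrthogonal B R = selfOrthogonal (B.compr₂ f) R := by
    ext U
    refine and_congr_right fun hUR ↦ forall₂_congr fun v hv ↦ ?_
    refine iff_congr Iff.rfl (forall₂_congr fun u hu ↦ ?_)
    exact (hf _ (hR u (hUR hu) v hv)).symm
  rw [heq]
  exact ncard_selfOrthogonal_le_of_form (fun v ↦ by simp [hB]) _ R rfl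

theorem ncard_selfOrthogonal_le {B : V →ₗ[F] V →ₗ[F] W} (hB : ∀ v, B v v = 0) :
    ∀ (m : ℕ) (T : Submodule F V), finrank F T = m →
      ((selfOrthogonal B T).ncard : ℝ) ≤ (Fintype.card F : ℝ) ^ ((m : ℝ) ^ 2 / 6 + 4 * m) := by
  have : Module.Finite F V := Module.Finite.of_finite
  have hq : (2 : ℝ) ≤ Fintype.card F := by exact_mod_cast Fintype.one_lt_card (α := F)
  have hq1 : (1 : ℝ) ≤ Fintype.card F := by linarith
  intro m
  induction m using Nat.strong_induction_on with
  | _ m ih =>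
  intro T hT
  set q : ℝ := (Fintype.card F : ℝ)
  rcases Nat.eq_zero_or_pos m with rfl | hm
  · have hsub : selfOrthogonal B T ⊆ {⊥} := by
      intro U hU
      rw [Submodule.finrank_eq_zero] at hT
      exact le_bot_iff.1 (hT ▸ hU.1)
    have := Set.ncard_le_ncard hsub
    rw [Set.ncard_singleton] at this
    simpa using this
  have hm1 : (1 : ℝ) ≤ m := by exact_mod_cast hm
  set e : ℝ := (m : ℝ) ^ 2 / 6 + 3 * m - 2 with he
  have he0 : 0 ≤ e := by nlinarith
  have hDT : ∀ D : Set V, D ⊆ T → (D.ncard : ℝ) ≤ q ^ (m : ℝ) := by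
    intro D hD
    rw [← hT, ← Submodule.ncard_eq_card_pow_finrank]
    exact_mod_cast Set.ncard_le_ncard hD
  have hcount : ∀ (S : Set (Submodule F V)) (D : Set V) (A : V → Set (Submodule F V)), D ⊆ T →
      (∀ U ∈ S, ∃ u ∈ D, U ∈ A u) → (∀ u ∈ D, ((A u).ncard : ℝ) ≤ q ^ e) →
      (S.ncard : ℝ) ≤ q ^ (m + e) := by
    intro S D A hD hS hA
    rw [Real.rpow_add (by linarith)]
    exact (ncard_le_ncard_mul_of_forall_exists A hS hA).trans (by gcongr; exact hDT D hD)
  let S₁ := {U ∈ selfOrthogonal B T | ∃ u ∈ U, 2 ≤ finrank F (T.map (B u))}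
  let S₂ := {U ∈ selfOrthogonal B T | ∃ u ∈ U, U = T ⊓ LinearMap.ker (B u)}
  let S₃ := {U ∈ selfOrthogonal B T | ∃ u ∈ U, finrank F (T.map (B u)) ≤ 1 ∧
    ∀ u' ∈ U, ∀ v ∈ T, B u' v ∈ T.map (B u)}
  have h₁ : (S₁.ncard : ℝ) ≤ q ^ (m + e) := by
    refine hcount S₁ {u | u ∈ T ∧ 2 ≤ finrank F (T.map (B u))}
      (fun u ↦ {U ∈ selfOrthogonal B T | u ∈ U}) (fun u hu ↦ hu.1) ?_ ?_
    · rintro U ⟨hU, u, hu, h⟩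
      exact ⟨u, ⟨hU.1 hu, h⟩, hU, hu⟩
    · rintro u ⟨huT, hu⟩
      have hu0 : u ≠ 0 := by
        rintro rfl
        rw [map_zero, Submodule.map_zero, finrank_bot] at hu
        omega
      obtain ⟨T', hT'T, hT', hle⟩ := exists_ncard_selfOrthogonal_le hB huT hu0
      have h1 := finrank_inf_ker_add_finrank_map (B u) T
      have h2 : (finrank F T' : ℝ) + 3 ≤ m := by
        have : finrank F T' + 3 ≤ m := by omega
        exact_mod_cast this
      have h0 : (0 : ℝ) ≤ finrank F T' := by positivity
      calc ({U ∈ selfOrthogonal B T | u ∈ U}.ncard : ℝ) ≤ (selfOrthogonal B T').ncard := by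
            exact_mod_cast hle
        _ ≤ _ := ih _ (by omega) T' rfl
        _ ≤ _ := by
            apply Real.rpow_le_rpow_of_exponent_le hq1
            nlinarith
  have h₂ : (S₂.ncard : ℝ) ≤ q ^ (m + e) := by
    refine hcount S₂ T (fun u ↦ {T ⊓ LinearMap.ker (B u)}) subset_rfl ?_ ?_
    · rintro U ⟨hU, u, hu, h⟩
      exact ⟨u, hU.1 hu, h⟩
    · intro u _
      rw [Set.ncard_singleton]
      exact_mod_cast Real.one_le_rpow hq1 he0
  have h₃ : (S₃.ncard : ℝ) ≤ q ^ (m + e) := by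
    let R : V → Submodule F V := fun u ↦
      T ⊓ ⨅ v ∈ T, (T.map (B u)).comap (B.flip v)
    have hRmem : ∀ u x, x ∈ R u ↔ x ∈ T ∧ ∀ v ∈ T, B x v ∈ T.map (B u) := by
      intro u x
      simp [R, Submodule.mem_iInf]
    refine hcount S₃ {u | u ∈ T ∧ finrank F (T.map (B u)) ≤ 1}
      (fun u ↦ selfOrthogonal B (R u)) (fun u hu ↦ hu.1) ?_ ?_
    · rintro U ⟨hU, u, hu, h1, h2⟩
      exact ⟨u, ⟨hU.1 hu, h1⟩, selfOrthogonal_subset_of_le inf_le_left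
        (fun x hx ↦ (hRmem u x).2 ⟨hU.1 hx, h2 x hx⟩) hU⟩
    · rintro u ⟨huT, hu⟩
      have h1 := ncard_selfOrthogonal_le_of_finrank_le_one hB hu (R := R u)
        fun v hv w hw ↦ ((hRmem u v).1 hv).2 w ((hRmem u w).1 hw).1
      have h2 : (finrank F (R u) : ℝ) ≤ m := by
        rw [← hT]
        exact_mod_cast Submodule.finrank_mono (inf_le_left : R u ≤ T)
      have h0 : (0 : ℝ) ≤ finrank F (R u) := by positivity
      refine h1.trans (Real.rpow_le_rpow_of_exponent_le hq1 ?_)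
      nlinarith
  have hsub : selfOrthogonal B T ⊆ S₁ ∪ S₂ ∪ S₃ := by
    intro U hU
    by_cases h : ∃ u ∈ U, 2 ≤ finrank F (T.map (B u))
    · exact .inl (.inl ⟨hU, h⟩)
    push Not at h
    have h' : ∀ u ∈ U, finrank F (T.map (B u)) ≤ 1 := fun u hu ↦ Nat.le_of_lt_succ (h u hu)
    rcases eq_inf_ker_or_apply_mem_map hU h' with h2 | ⟨u, hu, h3⟩
    · exact .inl (.inr ⟨hU, h2⟩)
    · exact .inr ⟨hU, u, hu, h' u hu, h3⟩
  have hsum : ((selfOrthogonal B T).ncard : ℝ) ≤ S₁.ncard + S₂.ncard + S₃.ncard := by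
    have := (Set.ncard_le_ncard hsub).trans ((Set.ncard_union_le _ _).trans
      (Nat.add_le_add_right (Set.ncard_union_le _ _) _))
    exact_mod_cast this
  have hpos : 0 ≤ q ^ (m + e) := by positivity
  calc ((selfOrthogonal B T).ncard : ℝ) ≤ 2 ^ 2 * q ^ (m + e) := by linarith
    _ ≤ q ^ 2 * q ^ (m + e) := by gcongr
    _ = q ^ ((m : ℝ) ^ 2 / 6 + 4 * m) := by
        rw [← Real.rpow_two, ← Real.rpow_add (by linarith)]
        congr 1
        rw [he]
        ring

end SelfOrthogonal

/-- There is an absolute constant `C` such that for every finite field `F_q`,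
every `n ≥ 1`, and every alternating matrix space `𝒜 ≤ Λ(n, F_q)`, the number of maximal
isotropic spaces of `𝒜` is at most `q^{n²/6 + C·n}` (as real numbers). -/
theorem stmt_12 :
    ∃ C : ℝ, ∀ (F : Type) [Field F] [Fintype F] (n : ℕ), 1 ≤ n →
      ∀ 𝒜 : Submodule F (Matrix (Fin n) (Fin n) F),
        (∀ A ∈ 𝒜, ∀ v : Fin n → F, v ⬝ᵥ A *ᵥ v = 0) →
        (Nat.card {U : Submodule F (Fin n → F) //
            (∀ u ∈ U, ∀ u' ∈ U, ∀ A ∈ 𝒜, u ⬝ᵥ A *ᵥ u' = 0) ∧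
            (∀ W : Submodule F (Fin n → F),
              (∀ u ∈ W, ∀ u' ∈ W, ∀ A ∈ 𝒜, u ⬝ᵥ A *ᵥ u' = 0) → U ≤ W → W = U)} : ℝ)
          ≤ (Fintype.card F : ℝ) ^ ((n : ℝ) ^ 2 / 6 + C * n) := by
  refine ⟨4, fun F _ _ n _ 𝒜 h𝒜 ↦ ?_⟩
  let B : (Fin n → F) →ₗ[F] (Fin n → F) →ₗ[F] (𝒜 → F) :=
    LinearMap.mk₂ F (fun u v A ↦ u ⬝ᵥ A.1 *ᵥ v)
      (fun _ _ _ ↦ funext fun _ ↦ add_dotProduct _ _ _)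
      (fun _ _ _ ↦ funext fun _ ↦ smul_dotProduct _ _ _)
      (fun _ _ _ ↦ funext fun _ ↦ by simp [mulVec_add])
      (fun _ _ _ ↦ funext fun _ ↦ by simp [mulVec_smul])
  have hB : ∀ v, B v v = 0 := fun v ↦ funext fun A ↦ h𝒜 A.1 A.2 v
  have hB0 : ∀ u v, B u v = 0 ↔ ∀ A ∈ 𝒜, u ⬝ᵥ A *ᵥ v = 0 := fun u v ↦
    ⟨fun h A hA ↦ congrFun h ⟨A, hA⟩, fun h ↦ funext fun A ↦ h A.1 A.2⟩
  simp only [← hB0]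
  have h := ncard_selfOrthogonal_le hB n ⊤ (by simp)
  refine le_trans ?_ h
  rw [Nat.cast_le]
  refine Set.ncard_le_ncard (s := {U : Submodule F (Fin n → F) | _}) ?_
  rintro U ⟨hU, hmax⟩
  refine ⟨le_top, fun v _ ↦ ⟨fun hv u hu ↦ hU u hu v hv, fun hv ↦ ?_⟩⟩
  have hv' : ∀ u ∈ U, B v u = 0 := fun u hu ↦ by simpa [hB, hv u hu] using hB (u + v)
  rw [← hmax (U ⊔ Submodule.span F {v}) ?_ le_sup_left]
  · exact le_sup_right (a := U) (Submodule.mem_span_singleton_self v)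
  intro x hx y hy
  obtain ⟨u, hu, w, hw, rfl⟩ := Submodule.mem_sup.1 hx
  obtain ⟨c, rfl⟩ := Submodule.mem_span_singleton.1 hw
  obtain ⟨u', hu', w', hw', rfl⟩ := Submodule.mem_sup.1 hy
  obtain ⟨c', rfl⟩ := Submodule.mem_span_singleton.1 hw'
  simp [hU u hu u' hu', hv u hu, hv' u' hu', hB]
end

section
/- There exists an absolute constant D such that for every prime power q, every n ≥ 1, and every alternating matrix A ∈ Λ(n, F_q) of rank strictly greater than 2n/3, the number of isotropic spaces of A is at most q^{n²/6 + D·n} (as real numbers). -/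
open Matrix

/-- There are at least `q ^ (d * d - d)` bases of a `d`-dimensional space over `F_q`. -/
theorem pow_le_card_linearIndependent_mul {F E : Type*} [Field F] [Fintype F] [AddCommGroup E]
    [Module F E] [Finite E] {d : ℕ} (hd : Module.finrank F E = d) :
    Fintype.card F ^ (d * d) ≤
      Nat.card {w : Fin d → E // LinearIndependent F w} * Fintype.card F ^ d := by
  have hq : 2 ≤ Fintype.card F := Fintype.one_lt_card
  have : Fintype E := Fintype.ofFinite E
  rw [card_linearIndependent (K := F) (V := E) hd.ge, hd]
  set q := Fintype.card F
  have h : ∀ i : Fin d, q ^ d ≤ (q ^ d - q ^ (i : ℕ)) * q := by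
    intro i
    obtain ⟨e, rfl⟩ : ∃ e, d = e + 1 := ⟨d - 1, by have := i.2; omega⟩
    have h1 : q ^ (i : ℕ) ≤ q ^ e := Nat.pow_le_pow_right (by omega) (by have := i.2; omega)
    have h2 : q ^ e ≤ q ^ (e + 1) - q ^ (i : ℕ) := by
      have : q ^ e * 2 ≤ q ^ (e + 1) := by rw [pow_succ]; gcongr
      omega
    calc q ^ (e + 1) = q ^ e * q := pow_succ _ _
      _ ≤ _ := by gcongr
  calc q ^ (d * d) = ∏ _i : Fin d, q ^ d := by simp [pow_mul]
    _ ≤ ∏ i : Fin d, (q ^ d - q ^ (i : ℕ)) * q := Finset.prod_le_prod' fun i _ => h i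
    _ = _ := by simp [Finset.prod_mul_distrib]

/-- A lower bound for the number of tuples whose image under `g` is a basis of the range of `g`. -/
theorem pow_le_card_linearIndependent_comp_mul {F E V : Type*} [Field F] [Fintype F]
    [AddCommGroup E] [Module F E] [Finite E] [AddCommGroup V] [Module F V] {a b : ℕ}
    (g : E →ₗ[F] V) (ha : Module.finrank F (LinearMap.ker g) = a)
    (hb : Module.finrank F (LinearMap.range g) = b) :
    Fintype.card F ^ (b * b + a * b) ≤
      Nat.card {v : Fin b → E // LinearIndependent F (g ∘ v)} * Fintype.card F ^ b := by
  have : Finite (LinearMap.range g) := Finite.of_surjective _ g.surjective_rangeRestrict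
  have hcard : Nat.card (Fin b → LinearMap.ker g) = Fintype.card F ^ (a * b) := by
    rw [Nat.card_fun, Module.natCard_eq_pow_finrank (K := F) (V := LinearMap.ker g), ha,
      Nat.card_eq_fintype_card, Nat.card_eq_fintype_card, Fintype.card_fin, pow_mul]
  choose s hs using fun y : LinearMap.range g => y.2
  have hinj : Nat.card ({y : Fin b → LinearMap.range g // LinearIndependent F y} ×
        (Fin b → LinearMap.ker g)) ≤
      Nat.card {v : Fin b → E // LinearIndependent F (g ∘ v)} := by
    refine Nat.card_le_card_of_injective
      (fun p => ⟨fun j => s (p.1.1 j) + p.2 j, ?_⟩) ?_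
    · have : g ∘ (fun j => s (p.1.1 j) + (p.2 j : E)) =
          (LinearMap.range g).subtype ∘ p.1.1 := by
        funext j
        simp [hs]
      rw [this]
      exact p.1.2.map' _ (Submodule.ker_subtype _)
    · rintro ⟨⟨y, hy⟩, w⟩ ⟨⟨y', hy'⟩, w'⟩ h
      have h1 : ∀ j, s (y j) + (w j : E) = s (y' j) + w' j := fun j =>
        congrFun (congrArg Subtype.val h) j
      have h2 : y = y' := by
        funext j
        have := congrArg g (h1 j)
        simp only [map_add, hs, LinearMap.map_coe_ker, add_zero] at this
        exact Subtype.ext this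
      subst h2
      have h3 : w = w' := by
        funext j
        exact Subtype.ext (add_left_cancel (h1 j))
      subst h3
      rfl
  rw [Nat.card_prod, hcard] at hinj
  calc Fintype.card F ^ (b * b + a * b)
      = Fintype.card F ^ (b * b) * Fintype.card F ^ (a * b) := pow_add _ _ _
    _ ≤ (Nat.card {y : Fin b → LinearMap.range g // LinearIndependent F y} *
          Fintype.card F ^ b) * Fintype.card F ^ (a * b) := by
        gcongr
        exact pow_le_card_linearIndependent_mul hb
    _ = (Nat.card {y : Fin b → LinearMap.range g // LinearIndependent F y} *
          Fintype.card F ^ (a * b)) * Fintype.card F ^ b := by ring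
    _ ≤ _ := by gcongr

theorem card_dotProduct_eq_zero_mul {F : Type*} [Field F] [Fintype F] {n b : ℕ}
    {y : Fin b → Fin n → F} (hy : LinearIndependent F y) :
    Nat.card {x : Fin n → F // ∀ j, x ⬝ᵥ y j = 0} * Fintype.card F ^ b = Fintype.card F ^ n := by
  have h1 : (Matrix.of y).rank = b := by
    simpa using LinearIndependent.rank_matrix (M := Matrix.of y) hy
  have h2 := LinearMap.finrank_range_add_finrank_ker (Matrix.of y).mulVecLin
  rw [Module.finrank_fin_fun, ← Matrix.rank, h1] at h2
  have h3 : Nat.card {x : Fin n → F // ∀ j, x ⬝ᵥ y j = 0} =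
      Nat.card (LinearMap.ker (Matrix.of y).mulVecLin) := by
    refine Nat.card_congr (Equiv.subtypeEquivRight fun x => ?_)
    rw [LinearMap.mem_ker, Matrix.mulVecLin_apply, funext_iff]
    refine forall_congr' fun j => ?_
    rw [dotProduct_comm]
    rfl
  rw [h3, Module.natCard_eq_pow_finrank (K := F), Nat.card_eq_fintype_card, ← pow_add, add_comm,
    h2]

/-- The number of isotropic `b`-tuples that are independent modulo the kernel of `A`. -/
theorem card_isotropic_tuple_mul_le {F : Type*} [Field F] [Fintype F] {n : ℕ}
    (A : Matrix (Fin n) (Fin n) F) (b : ℕ) :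
    Nat.card {v : Fin b → Fin n → F //
        LinearIndependent F (A.mulVecLin ∘ v) ∧ ∀ i j, v i ⬝ᵥ A *ᵥ v j = 0} *
      Fintype.card F ^ (∑ j ∈ Finset.range b, j) ≤ Fintype.card F ^ (n * b) := by
  induction b with
  | zero =>
    simp only [Finset.range_zero, Finset.sum_empty, pow_zero, mul_one, mul_zero]
    exact Finite.card_le_one_iff_subsingleton.2 inferInstance
  | succ b ih =>
    let S : ℕ → Type _ := fun b => {v : Fin b → Fin n → F //
        LinearIndependent F (A.mulVecLin ∘ v) ∧ ∀ i j, v i ⬝ᵥ A *ᵥ v j = 0}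
    let f : S (b + 1) → Σ v : S b, {x : Fin n → F // ∀ j, x ⬝ᵥ (A.mulVecLin ∘ v.1) j = 0} :=
      fun v => ⟨⟨fun j => v.1 j.castSucc,
        v.2.1.comp _ (Fin.castSucc_injective b), fun i j => v.2.2 _ _⟩,
        ⟨v.1 (Fin.last b), fun j => v.2.2 _ _⟩⟩
    have hf : Function.Injective f := by
      intro v v' h
      have h1 : ∀ j : Fin b, v.1 j.castSucc = v'.1 j.castSucc := fun j =>
        congrFun (congrArg (fun t => t.1.1) h) j
      have h2 : v.1 (Fin.last b) = v'.1 (Fin.last b) := congrArg (fun t => t.2.1) h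
      refine Subtype.ext (funext fun j => ?_)
      induction j using Fin.lastCases with
      | last => exact h2
      | cast j => exact h1 j
    have : Fintype (S b) := Fintype.ofFinite _
    have hcard : Nat.card (S (b + 1)) * Fintype.card F ^ b ≤
        Nat.card (S b) * Fintype.card F ^ n := by
      calc Nat.card (S (b + 1)) * Fintype.card F ^ b
          ≤ Nat.card (Σ v : S b, {x : Fin n → F // ∀ j, x ⬝ᵥ (A.mulVecLin ∘ v.1) j = 0}) *
              Fintype.card F ^ b :=
            Nat.mul_le_mul_right _ (Nat.card_le_card_of_injective f hf)
        _ = Nat.card (S b) * Fintype.card F ^ n := by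
            rw [Nat.card_sigma, Finset.sum_mul,
              Finset.sum_congr rfl fun v _ => card_dotProduct_eq_zero_mul v.2.1]
            simp [Nat.card_eq_fintype_card]
    rw [Finset.sum_range_succ]
    calc Nat.card (S (b + 1)) * Fintype.card F ^ (∑ j ∈ Finset.range b, j + b)
        = (Nat.card (S (b + 1)) * Fintype.card F ^ b) *
            Fintype.card F ^ (∑ j ∈ Finset.range b, j) := by ring
      _ ≤ (Nat.card (S b) * Fintype.card F ^ n) *
            Fintype.card F ^ (∑ j ∈ Finset.range b, j) := by gcongr
      _ = (Nat.card (S b) * Fintype.card F ^ (∑ j ∈ Finset.range b, j)) *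
            Fintype.card F ^ n := by ring
      _ ≤ Fintype.card F ^ (n * b) * Fintype.card F ^ n := by gcongr
      _ = _ := by ring

theorem span_sup_span_eq_top {F E V : Type*} [Field F] [AddCommGroup E] [Module F E]
    [FiniteDimensional F E] [AddCommGroup V] [Module F V] {a b : ℕ} (g : E →ₗ[F] V)
    (ha : Module.finrank F (LinearMap.ker g) = a) (hb : Module.finrank F (LinearMap.range g) = b)
    {w : Fin a → LinearMap.ker g} (hw : LinearIndependent F w)
    {v : Fin b → E} (hv : LinearIndependent F (g ∘ v)) :
    Submodule.span F (Set.range v) ⊔ Submodule.span F (Set.range fun i => (w i : E)) = ⊤ := by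
  have h1 : Submodule.span F (Set.range fun i => (w i : E)) = LinearMap.ker g := by
    refine Submodule.eq_of_le_of_finrank_eq ?_ ?_
    · rw [Submodule.span_le]
      rintro _ ⟨i, rfl⟩
      exact (w i).2
    · rw [ha]
      exact (finrank_span_eq_card (hw.map' _ (Submodule.ker_subtype (LinearMap.ker g)))).trans
        (Fintype.card_fin a)
  have h2 : (Submodule.span F (Set.range v)).map g = LinearMap.range g := by
    refine Submodule.eq_of_le_of_finrank_eq LinearMap.map_le_range ?_
    rw [hb, Submodule.map_span, ← Set.range_comp]
    simpa using finrank_span_eq_card hv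
  rw [h1, ← Submodule.comap_map_eq, h2, eq_top_iff]
  exact fun x _ => ⟨x, rfl⟩

/-- The number of isotropic spaces meeting the kernel of `A` in dimension `a` and with image of
dimension `b`. -/
theorem card_isotropic_mul_le {F : Type*} [Field F] [Fintype F] {n : ℕ}
    (A : Matrix (Fin n) (Fin n) F) (a b : ℕ) :
    Nat.card {U : Submodule F (Fin n → F) //
        (∀ u ∈ U, ∀ u' ∈ U, u ⬝ᵥ A *ᵥ u' = 0) ∧
        Module.finrank F (LinearMap.ker (A.mulVecLin.domRestrict U)) = a ∧
        Module.finrank F (LinearMap.range (A.mulVecLin.domRestrict U)) = b} *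
      Fintype.card F ^ (a * a + (b * b + a * b) + ∑ j ∈ Finset.range b, j) ≤
    Fintype.card F ^ ((n - A.rank) * a + n * b + a + b) := by
  set q := Fintype.card F
  let X := {U : Submodule F (Fin n → F) //
        (∀ u ∈ U, ∀ u' ∈ U, u ⬝ᵥ A *ᵥ u' = 0) ∧
        Module.finrank F (LinearMap.ker (A.mulVecLin.domRestrict U)) = a ∧
        Module.finrank F (LinearMap.range (A.mulVecLin.domRestrict U)) = b}
  let T : X → Type _ := fun U =>
    {w : Fin a → LinearMap.ker (A.mulVecLin.domRestrict U.1) // LinearIndependent F w} ×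
    {v : Fin b → U.1 // LinearIndependent F (A.mulVecLin.domRestrict U.1 ∘ v)}
  let S := {v : Fin b → Fin n → F //
        LinearIndependent F (A.mulVecLin ∘ v) ∧ ∀ i j, v i ⬝ᵥ A *ᵥ v j = 0}
  have : Fintype X := Fintype.ofFinite _
  let Φ : (Σ U : X, T U) → (Fin a → LinearMap.ker A.mulVecLin) × S := fun p =>
    ⟨fun i => ⟨((p.2.1.1 i : p.1.1) : Fin n → F), (p.2.1.1 i).2⟩,
      ⟨fun j => p.2.2.1 j, p.2.2.2, fun i j => p.1.2.1 _ (p.2.2.1 i).2 _ (p.2.2.1 j).2⟩⟩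
  have hspan : ∀ p : Σ U : X, T U, p.1.1 =
      Submodule.span F (Set.range fun j => ((Φ p).2.1 j)) ⊔
      Submodule.span F (Set.range fun i => ((Φ p).1 i : Fin n → F)) := by
    rintro ⟨⟨U, hU, ha, hb⟩, ⟨w, hw⟩, ⟨v, hv⟩⟩
    have h := congrArg (Submodule.map U.subtype)
      (span_sup_span_eq_top (A.mulVecLin.domRestrict U) ha hb hw hv)
    rw [Submodule.map_sup, Submodule.map_span, Submodule.map_span, ← Set.range_comp,
      ← Set.range_comp, Submodule.map_top, Submodule.range_subtype] at h
    exact h.symm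
  have hΦ : Function.Injective Φ := by
    intro p p' h
    have hU : p.1 = p'.1 := Subtype.ext (by rw [hspan p, hspan p', h])
    obtain ⟨U, ⟨w, hw⟩, ⟨v, hv⟩⟩ := p
    obtain ⟨U', ⟨w', hw'⟩, ⟨v', hv'⟩⟩ := p'
    obtain rfl : U = U' := hU
    have h1 : w = w' := funext fun i => Subtype.ext (Subtype.ext
      (congrArg (fun t => (t.1 i : Fin n → F)) h))
    have h2 : v = v' := funext fun j => Subtype.ext
      (congrFun (congrArg (fun t => t.2.1) h) j)
    subst h1 h2
    rfl
  have hT : ∀ U : X, q ^ (a * a + (b * b + a * b)) ≤ Nat.card (T U) * q ^ (a + b) := by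
    intro U
    have h1 := pow_le_card_linearIndependent_mul (F := F)
      (E := LinearMap.ker (A.mulVecLin.domRestrict U.1)) U.2.2.1
    have h2 := pow_le_card_linearIndependent_comp_mul _ U.2.2.1 U.2.2.2
    calc q ^ (a * a + (b * b + a * b)) = q ^ (a * a) * q ^ (b * b + a * b) := pow_add _ _ _
      _ ≤ _ := Nat.mul_le_mul h1 h2
      _ = Nat.card (T U) * q ^ (a + b) := by
        simp only [T, Nat.card_prod]
        ring
  have hcount : Nat.card X * q ^ (a * a + (b * b + a * b)) ≤
      Nat.card (Σ U : X, T U) * q ^ (a + b) := by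
    rw [Nat.card_sigma, Finset.sum_mul]
    calc _ = ∑ _U : X, q ^ (a * a + (b * b + a * b)) := by simp [Nat.card_eq_fintype_card]
      _ ≤ _ := Finset.sum_le_sum fun U _ => hT U
  have hker : Module.finrank F (LinearMap.ker A.mulVecLin) = n - A.rank := by
    have := LinearMap.finrank_range_add_finrank_ker A.mulVecLin
    rw [Module.finrank_fin_fun, ← Matrix.rank] at this
    omega
  have hw : Nat.card (Fin a → LinearMap.ker A.mulVecLin) = q ^ ((n - A.rank) * a) := by
    rw [Nat.card_fun, Module.natCard_eq_pow_finrank (K := F) (V := LinearMap.ker A.mulVecLin),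
      hker, Nat.card_eq_fintype_card, Nat.card_eq_fintype_card, Fintype.card_fin, pow_mul]
  have hle := Nat.card_le_card_of_injective Φ hΦ
  rw [Nat.card_prod, hw] at hle
  calc Nat.card X * q ^ (a * a + (b * b + a * b) + ∑ j ∈ Finset.range b, j)
      = (Nat.card X * q ^ (a * a + (b * b + a * b))) * q ^ (∑ j ∈ Finset.range b, j) := by ring
    _ ≤ ((q ^ ((n - A.rank) * a) * Nat.card S) * q ^ (a + b)) *
          q ^ (∑ j ∈ Finset.range b, j) := by
        refine Nat.mul_le_mul_right _ (hcount.trans ?_)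
        gcongr
    _ = q ^ ((n - A.rank) * a) * q ^ (a + b) *
          (Nat.card S * q ^ (∑ j ∈ Finset.range b, j)) := by ring
    _ ≤ q ^ ((n - A.rank) * a) * q ^ (a + b) * q ^ (n * b) := by
        gcongr
        exact card_isotropic_tuple_mul_le A b
    _ = _ := by ring

theorem card_isotropic_le_rpow {F : Type*} [Field F] [Fintype F] {n : ℕ}
    (A : Matrix (Fin n) (Fin n) F) (hA : 2 * n < 3 * A.rank) {a b : ℕ} (ha : a ≤ n) (hb : b ≤ n) :
    (Nat.card {U : Submodule F (Fin n → F) //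
        (∀ u ∈ U, ∀ u' ∈ U, u ⬝ᵥ A *ᵥ u' = 0) ∧
        Module.finrank F (LinearMap.ker (A.mulVecLin.domRestrict U)) = a ∧
        Module.finrank F (LinearMap.range (A.mulVecLin.domRestrict U)) = b} : ℝ) ≤
      (Fintype.card F : ℝ) ^ ((n : ℝ) ^ 2 / 6 + 3 * n) := by
  have hq : (1 : ℝ) < Fintype.card F := by exact_mod_cast Fintype.one_lt_card
  have hq0 : (0 : ℝ) < Fintype.card F := by linarith
  have h := card_isotropic_mul_le A a b
  have hs := Finset.sum_range_id_mul_two b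
  have hs' : ((∑ j ∈ Finset.range b, j : ℕ) : ℝ) * 2 = b * b - b := by
    rcases b with _ | b
    · simp
    · rw [Nat.add_sub_cancel] at hs
      have : ((∑ j ∈ Finset.range (b + 1), j : ℕ) : ℝ) * 2 = (b + 1) * b := by exact_mod_cast hs
      rw [this]
      push_cast
      ring
  set s := ∑ j ∈ Finset.range b, j
  set k := n - A.rank
  have hk : (3 : ℝ) * k ≤ n := by
    have : 3 * k ≤ n := by omega
    exact_mod_cast this
  set N := Nat.card {U : Submodule F (Fin n → F) //
        (∀ u ∈ U, ∀ u' ∈ U, u ⬝ᵥ A *ᵥ u' = 0) ∧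
        Module.finrank F (LinearMap.ker (A.mulVecLin.domRestrict U)) = a ∧
        Module.finrank F (LinearMap.range (A.mulVecLin.domRestrict U)) = b}
  have h' : (N : ℝ) * (Fintype.card F : ℝ) ^ (((a * a + (b * b + a * b) + s : ℕ)) : ℝ) ≤
      (Fintype.card F : ℝ) ^ (((k * a + n * b + a + b : ℕ)) : ℝ) := by
    rw [Real.rpow_natCast, Real.rpow_natCast]
    exact_mod_cast h
  rw [← le_div_iff₀ (Real.rpow_pos_of_pos hq0 _), ← Real.rpow_sub hq0] at h'
  refine h'.trans (Real.rpow_le_rpow_of_exponent_le hq.le ?_)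
  push_cast
  have ha' : (a : ℝ) ≤ n := by exact_mod_cast ha
  have hb' : (b : ℝ) ≤ n := by exact_mod_cast hb
  have ha0 : (0 : ℝ) ≤ a := a.cast_nonneg
  have hak : (3 : ℝ) * k * a ≤ n * a := by gcongr
  have hsq := sq_nonneg ((n : ℝ) / 3 - b - 2 * a)
  have hsq' := sq_nonneg ((n : ℝ) / 3 - b)
  nlinarith

open Matrix

/-- There is an absolute constant `D` such that for every finite field `F_q`,
every `n ≥ 1`, and every alternating matrix `A ∈ Λ(n, F_q)` of rank `> 2n/3`, the number of
isotropic spaces of `A` is at most `q^{n²/6 + D·n}` (as real numbers). -/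
theorem stmt_13 :
    ∃ D : ℝ, ∀ (F : Type) [Field F] [Fintype F] (n : ℕ), 1 ≤ n →
      ∀ A : Matrix (Fin n) (Fin n) F,
        (∀ v : Fin n → F, v ⬝ᵥ A *ᵥ v = 0) →
        3 * A.rank > 2 * n →
        (Nat.card {U : Submodule F (Fin n → F) //
            ∀ u ∈ U, ∀ u' ∈ U, u ⬝ᵥ A *ᵥ u' = 0} : ℝ)
          ≤ (Fintype.card F : ℝ) ^ ((n : ℝ) ^ 2 / 6 + D * n) := by
  refine ⟨5, fun F _ _ n _ A _ hA => ?_⟩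
  classical
  have hq : (2 : ℝ) ≤ Fintype.card F := by
    exact_mod_cast (Fintype.one_lt_card : 1 < Fintype.card F)
  have hq0 : (0 : ℝ) < Fintype.card F := by linarith
  let X := {U : Submodule F (Fin n → F) // ∀ u ∈ U, ∀ u' ∈ U, u ⬝ᵥ A *ᵥ u' = 0}
  have : Fintype X := Fintype.ofFinite _
  let f : X → ℕ × ℕ := fun U =>
    (Module.finrank F (LinearMap.ker (A.mulVecLin.domRestrict U.1)),
      Module.finrank F (LinearMap.range (A.mulVecLin.domRestrict U.1)))
  set M : ℝ := (Fintype.card F : ℝ) ^ ((n : ℝ) ^ 2 / 6 + 3 * n) with hM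
  have hM0 : 0 ≤ M := (Real.rpow_pos_of_pos hq0 _).le
  have hmaps : ∀ U ∈ (Finset.univ : Finset X),
      f U ∈ Finset.range (n + 1) ×ˢ Finset.range (n + 1) := by
    intro U _
    have h1 := LinearMap.finrank_range_add_finrank_ker (A.mulVecLin.domRestrict U.1)
    have h2 := Submodule.finrank_le U.1
    rw [Module.finrank_fin_fun] at h2
    simp only [Finset.mem_product, Finset.mem_range, f]
    omega
  have hfib : ∀ p ∈ Finset.range (n + 1) ×ˢ Finset.range (n + 1),
      (Finset.univ.filter fun U : X => f U = p).card ≤ ⌊M⌋₊ := by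
    rintro ⟨a, b⟩ hp
    simp only [Finset.mem_product, Finset.mem_range] at hp
    refine Nat.le_floor (le_trans ?_
      (card_isotropic_le_rpow A hA (Nat.lt_succ_iff.1 hp.1) (Nat.lt_succ_iff.1 hp.2)))
    rw [← Fintype.card_subtype, ← Nat.card_eq_fintype_card, Nat.cast_le]
    refine Nat.card_le_card_of_injective (fun U => ⟨U.1.1, U.1.2,
      congrArg Prod.fst U.2, congrArg Prod.snd U.2⟩) fun U U' h => ?_
    exact Subtype.ext (Subtype.ext (Subtype.mk.inj h))
  have hcard := Finset.card_le_mul_card_image_of_maps_to hmaps _ hfib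
  rw [Finset.card_product, Finset.card_range, Finset.card_univ, ← Nat.card_eq_fintype_card]
    at hcard
  have hn : (n : ℝ) + 1 ≤ (Fintype.card F : ℝ) ^ (n : ℝ) := by
    rw [Real.rpow_natCast]
    have h1 : n + 1 ≤ 2 ^ n := Nat.lt_two_pow_self
    calc (n : ℝ) + 1 ≤ 2 ^ n := by exact_mod_cast h1
      _ ≤ _ := by gcongr
  calc (Nat.card X : ℝ) ≤ (⌊M⌋₊ : ℝ) * (((n : ℝ) + 1) * (n + 1)) := by exact_mod_cast hcard
    _ ≤ M * ((Fintype.card F : ℝ) ^ (n : ℝ) * (Fintype.card F : ℝ) ^ (n : ℝ)) := by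
        gcongr
        exact Nat.floor_le hM0
    _ = _ := by
        rw [hM, ← Real.rpow_add hq0, ← Real.rpow_add hq0]
        congr 1
        ring
end

section
/- Let q be a prime power and 𝒜 ≤ Λ(n, F_q) a non-degenerate alternating matrix space. Let v ∈ F_qⁿ be a nonzero vector with deg_𝒜(v) = 1, let N(v) = {u ∈ F_qⁿ : uᵀAv ≠ 0 for some A ∈ 𝒜} ∪ {v}, and let N₁(v) = {w ∈ N(v) : deg_𝒜(w) = 1}. If |N₁(v)| > q^{2n/3}, then 𝒜 contains a matrix of rank strictly greater than 2n/3. -/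
open Matrix

/-- Polarization of the alternating identity. -/
theorem Matrix.dotProduct_mulVec_swap_of_alternating {F : Type*} [CommRing F] {n : ℕ}
    {A : Matrix (Fin n) (Fin n) F} (hA : ∀ v : Fin n → F, v ⬝ᵥ A *ᵥ v = 0) (x y : Fin n → F) :
    x ⬝ᵥ A *ᵥ y = -(y ⬝ᵥ A *ᵥ x) := by
  have h := hA (x + y)
  rw [Matrix.mulVec_add, dotProduct_add, add_dotProduct, add_dotProduct, hA x, hA y] at h
  linear_combination h

/-- If `w` has degree one in `𝒜`, all the images `A *ᵥ w` are multiples of any nonzero one. -/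
theorem Matrix.exists_mulVec_eq_smul_of_finrank_eq_one {F : Type*} [Field F] {n : ℕ}
    {𝒜 : Submodule F (Matrix (Fin n) (Fin n) F)} {w : Fin n → F}
    (hw : Module.finrank F (Submodule.span F {x : Fin n → F | ∃ A ∈ 𝒜, x = A *ᵥ w}) = 1)
    {B A : Matrix (Fin n) (Fin n) F} (hB : B ∈ 𝒜) (hBw : B *ᵥ w ≠ 0) (hA : A ∈ 𝒜) :
    ∃ c : F, A *ᵥ w = c • B *ᵥ w := by
  have mem {C : Matrix (Fin n) (Fin n) F} (hC : C ∈ 𝒜) :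
      C *ᵥ w ∈ Submodule.span F {x : Fin n → F | ∃ A ∈ 𝒜, x = A *ᵥ w} :=
    Submodule.subset_span ⟨C, hC, rfl⟩
  obtain ⟨c, hc⟩ := exists_smul_eq_of_finrank_eq_one hw (x := ⟨B *ᵥ w, mem hB⟩)
    (fun h => hBw (congrArg Subtype.val h)) ⟨A *ᵥ w, mem hA⟩
  exact ⟨c, (congrArg Subtype.val hc).symm⟩

/-- A matrix that is injective on a subspace has rank at least the dimension of the subspace. -/
theorem Matrix.finrank_le_rank_of_injOn {F : Type*} [Field F] {n : ℕ}
    {A : Matrix (Fin n) (Fin n) F} {W : Submodule F (Fin n → F)}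
    (hW : ∀ w ∈ W, A *ᵥ w = 0 → w = 0) : Module.finrank F W ≤ A.rank := by
  have hinj : Function.Injective (A.mulVecLin.rangeRestrict ∘ₗ W.subtype) := by
    rw [← LinearMap.ker_eq_bot, LinearMap.ker_eq_bot']
    intro w hw
    exact Subtype.ext (hW w w.2 (congrArg Subtype.val hw))
  exact LinearMap.finrank_le_finrank_of_injective hinj

/-- Let `𝒜 ≤ Λ(n, F_q)` be a non-degenerate alternating matrix space, `v ≠ 0` a
vector with `deg_𝒜(v) = 1`, `N(v)` its closed neighbourhood, and `N₁(v)` the set of degree-one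
vectors in `N(v)`. If `|N₁(v)| > q^{2n/3}` then `𝒜` contains a matrix of rank `> 2n/3`. -/
theorem stmt_14 (F : Type) [Field F] [Fintype F] (n : ℕ)
    (𝒜 : Submodule F (Matrix (Fin n) (Fin n) F))
    (halt : ∀ A ∈ 𝒜, ∀ v : Fin n → F, v ⬝ᵥ A *ᵥ v = 0)
    (hnd : ∀ v : Fin n → F, (∀ A ∈ 𝒜, A *ᵥ v = 0) → v = 0)
    (v : Fin n → F) (hv : v ≠ 0)
    (hdeg : Module.finrank F (Submodule.span F {w : Fin n → F | ∃ A ∈ 𝒜, w = A *ᵥ v}) = 1)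
    (hN1 : (Nat.card {w : Fin n → F //
        ((∃ A ∈ 𝒜, w ⬝ᵥ A *ᵥ v ≠ 0) ∨ w = v) ∧
        Module.finrank F (Submodule.span F {x : Fin n → F | ∃ A ∈ 𝒜, x = A *ᵥ w}) = 1} : ℝ)
      > (Fintype.card F : ℝ) ^ (2 * (n : ℝ) / 3)) :
    ∃ A ∈ 𝒜, 3 * A.rank > 2 * n := by
  obtain ⟨B, hB, hBv⟩ : ∃ B ∈ 𝒜, B *ᵥ v ≠ 0 := by
    by_contra! h
    exact hv (hnd v h)
  choose! c hc using fun A (hA : A ∈ 𝒜) =>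
    exists_mulVec_eq_smul_of_finrank_eq_one hdeg hB hBv hA
  let W : Submodule F (Fin n → F) := ⨅ A ∈ 𝒜, LinearMap.ker (A - c A • B).mulVecLin
  have mem_W (w : Fin n → F) : w ∈ W ↔ ∀ A ∈ 𝒜, A *ᵥ w = c A • B *ᵥ w := by
    simp [W, Submodule.mem_iInf, sub_eq_zero]
  have hsub (w : Fin n → F) (hw : ((∃ A ∈ 𝒜, w ⬝ᵥ A *ᵥ v ≠ 0) ∨ w = v) ∧
      Module.finrank F (Submodule.span F {x : Fin n → F | ∃ A ∈ 𝒜, x = A *ᵥ w}) = 1) :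
      w ∈ W := by
    obtain ⟨⟨C, hC, hCv⟩ | rfl, hw⟩ := hw
    · have hwB : v ⬝ᵥ B *ᵥ w ≠ 0 := by
        rw [dotProduct_mulVec_swap_of_alternating (halt B hB)]
        rw [hc C hC, dotProduct_smul] at hCv
        exact neg_ne_zero.mpr (right_ne_zero_of_smul hCv)
      refine (mem_W w).mpr fun A hA => ?_
      obtain ⟨d, hd⟩ := exists_mulVec_eq_smul_of_finrank_eq_one hw hB
        (fun h => hwB (by rw [h, dotProduct_zero])) hA
      have h : d * (v ⬝ᵥ B *ᵥ w) = c A * (v ⬝ᵥ B *ᵥ w) := by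
        rw [← smul_eq_mul, ← dotProduct_smul, ← hd,
          dotProduct_mulVec_swap_of_alternating (halt A hA), hc A hA, dotProduct_smul,
          dotProduct_mulVec_swap_of_alternating (halt B hB) v w, smul_eq_mul, mul_neg]
      rw [hd, mul_right_cancel₀ hwB h]
    · exact (mem_W w).mpr hc
  have hrank : Module.finrank F W ≤ B.rank := finrank_le_rank_of_injOn fun w hw hBw =>
    hnd w fun A hA => by rw [(mem_W w).mp hw A hA, hBw, smul_zero]
  have hcard := Nat.card_le_card_of_injective (Subtype.map id hsub)
    (Subtype.map_injective hsub Function.injective_id)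
  rw [Module.natCard_eq_pow_finrank (K := F) (V := W), Nat.card_eq_fintype_card (α := F)] at hcard
  have hlt : (Fintype.card F : ℝ) ^ (2 * (n : ℝ) / 3) <
      (Fintype.card F : ℝ) ^ (Module.finrank F W : ℝ) := by
    rw [Real.rpow_natCast]
    exact hN1.trans_le ((Nat.cast_le.mpr hcard).trans_eq (Nat.cast_pow _ _))
  rw [Real.rpow_lt_rpow_left_iff (mod_cast Fintype.one_lt_card)] at hlt
  have h : 2 * n < 3 * Module.finrank F W := by
    have : (2 * n : ℝ) < 3 * Module.finrank F W := by linarith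
    exact_mod_cast this
  exact ⟨B, hB, by omega⟩
end

section
/- There exists an absolute constant C such that for every field F, every n ≥ 2, and every alternating matrix space 𝒜 ≤ Λ(n,F) with Δ(𝒜) ≥ 1, one has χ(𝒜) ≤ C · Δ(𝒜) · log n. -/
open Matrix

/-- If every `P v` has codimension at most `D`, then cutting a subspace `W` by the `P v` with
`v ∈ s` lowers its dimension by at most `D * #s`. -/
theorem finrank_le_finrank_inf_add_card_mul {F V : Type*} [Field F] [AddCommGroup V] [Module F V]
    [FiniteDimensional F V] {P : V → Submodule F V} {D : ℕ}
    (hP : ∀ v, Module.finrank F V ≤ Module.finrank F (P v) + D)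
    (W : Submodule F V) (s : Finset V) :
    Module.finrank F W ≤ Module.finrank F (W ⊓ s.inf P : Submodule F V) + s.card * D := by
  classical
  induction s using Finset.induction_on with
  | empty => rw [Finset.inf_empty, inf_top_eq]; exact Nat.le_add_right _ _
  | insert a s ha ih =>
    have h1 := Submodule.finrank_sup_add_finrank_inf_eq (P a) (W ⊓ s.inf P)
    have h2 := Submodule.finrank_le (P a ⊔ (W ⊓ s.inf P))
    have h3 := hP a
    rw [Finset.inf_insert, Finset.card_insert_of_notMem ha, add_mul, one_mul, inf_left_comm]
    lia

/-- For a reflexive orthogonality relation given by subspaces `P v` of codimension at most `D`,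
every subspace `W` contains an isotropic subspace of dimension at least `dim W / (D + 1)`. -/
theorem exists_isotropic_le {F V : Type*} [Field F] [AddCommGroup V] [Module F V]
    [FiniteDimensional F V] {P : V → Submodule F V} {D : ℕ}
    (hP : ∀ v, Module.finrank F V ≤ Module.finrank F (P v) + D)
    (hself : ∀ v, v ∈ P v) (hsymm : ∀ v w, v ∈ P w → w ∈ P v) (W : Submodule F V) :
    ∃ U ≤ W, (∀ u ∈ U, ∀ u' ∈ U, u ∈ P u') ∧
      Module.finrank F W ≤ (D + 1) * Module.finrank F U := by
  classical
  obtain ⟨U, ⟨hUW, hU⟩, hmax⟩ := WellFounded.has_min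
    (wellFounded_gt (α := Submodule F V)) {U | U ≤ W ∧ ∀ u ∈ U, ∀ u' ∈ U, u ∈ P u'}
    ⟨⊥, bot_le, by simp⟩
  refine ⟨U, hUW, hU, ?_⟩
  obtain ⟨s, hcard, hspan⟩ : ∃ s : Finset V, s.card ≤ Module.finrank F U ∧
      Submodule.span F (s : Set V) = U := by
    let b := Module.finBasis F U
    refine ⟨Finset.univ.image fun i => (b i : V), by
      simpa using Finset.card_image_le (s := Finset.univ) (f := fun i => (b i : V)), ?_⟩
    have := congrArg (Submodule.map U.subtype) b.span_eq
    rw [Submodule.map_span, Submodule.map_subtype_top, ← Set.range_comp] at this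
    simpa [Function.comp_def] using this
  have hle : W ⊓ s.inf P ≤ U := by
    intro w hw
    obtain ⟨hwW, hws⟩ := Submodule.mem_inf.1 hw
    by_contra hwU
    have hUw : U ≤ P w := by
      rw [← hspan, Submodule.span_le]
      intro v hv
      exact hsymm _ _ (Finset.inf_le (f := P) hv hws)
    refine hmax (U ⊔ Submodule.span F {w}) ⟨sup_le hUW (by simpa using hwW), ?_⟩ ?_
    · have hw' : U ⊔ Submodule.span F {w} ≤ P w := sup_le hUw (by simpa using hself w)
      intro u hu u' hu'
      refine (sup_le (fun v hv => ?_) ?_ : U ⊔ Submodule.span F {w} ≤ P u') hu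
      · refine hsymm _ _ ((sup_le (fun x hx => hU x hx v hv) ?_ :
          U ⊔ Submodule.span F {w} ≤ P v) hu')
        simpa using hsymm _ _ (hUw hv)
      · simpa using hsymm _ _ (hw' hu')
    · refine lt_of_le_of_ne le_sup_left fun h => hwU ?_
      rw [h]
      exact Submodule.mem_sup_right (Submodule.mem_span_singleton_self w)
  have h1 := finrank_le_finrank_inf_add_card_mul hP W s
  have h2 := Submodule.finrank_mono hle
  have h3 := Nat.mul_le_mul_right D hcard
  linarith

/-- If every nonzero subspace `W` contains a subspace with property `Q` of dimension at least
`dim W / K`, then `W` is a direct sum of at most `1 + K log (dim W)` nonzero subspaces with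
property `Q`. -/
theorem exists_supIndep_card_le_log {F V : Type*} [Field F] [AddCommGroup V] [Module F V]
    [FiniteDimensional F V] {Q : Submodule F V → Prop} {K : ℕ}
    (hQ : ∀ W : Submodule F V, ∃ U ≤ W, Q U ∧ Module.finrank F W ≤ K * Module.finrank F U)
    (W : Submodule F V) (hW : W ≠ ⊥) :
    ∃ S : Finset (Submodule F V), (∀ U ∈ S, U ≠ ⊥ ∧ Q U) ∧ S.SupIndep id ∧ S.sup id = W ∧
      (S.card : ℝ) ≤ 1 + K * Real.log (Module.finrank F W) := by
  classical
  induction hm : Module.finrank F W using Nat.strong_induction_on generalizing W with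
  | _ m ih =>
    subst hm
    obtain ⟨U, hUW, hUQ, hUdim⟩ := hQ W
    have hWpos : 0 < Module.finrank F W :=
      Nat.pos_of_ne_zero fun h => hW (Submodule.finrank_eq_zero.1 h)
    have hKU : 0 < K * Module.finrank F U := hWpos.trans_le hUdim
    have hKpos : 0 < K := Nat.pos_of_mul_pos_right hKU
    have hUpos : 0 < Module.finrank F U := Nat.pos_of_mul_pos_left hKU
    have hU : U ≠ ⊥ := by
      rintro rfl
      rw [finrank_bot] at hUpos
      exact hUpos.false
    obtain ⟨W', hdisj, hsup⟩ : ∃ W', Disjoint U W' ∧ U ⊔ W' = W := by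
      obtain ⟨X, hX⟩ := Submodule.exists_isCompl U
      refine ⟨X ⊓ W, hX.disjoint.mono_right inf_le_left, ?_⟩
      rw [← sup_inf_assoc_of_le X hUW, hX.sup_eq_top, top_inf_eq]
    have hdim : Module.finrank F W = Module.finrank F U + Module.finrank F W' := by
      rw [← hsup, ← Submodule.finrank_sup_add_finrank_inf_eq, hdisj.eq_bot, finrank_bot, add_zero]
    by_cases hW' : W' = ⊥
    · refine ⟨{U}, by simp [hU, hUQ], Finset.supIndep_singleton _ _, by simp [← hsup, hW'], ?_⟩
      have : 0 ≤ Real.log (Module.finrank F W) := Real.log_natCast_nonneg _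
      simp only [Finset.card_singleton, Nat.cast_one]
      nlinarith [mul_nonneg (Nat.cast_nonneg (α := ℝ) K) this]
    · obtain ⟨S, hS, hind, hSsup, hcard⟩ := ih _ (by lia) W' hW' rfl
      refine ⟨insert U S, ?_, ?_, by simp [hSsup, hsup], ?_⟩
      · simpa [hU, hUQ] using hS
      · exact hind.insert (by simpa [hSsup] using hdisj)
      · have hW'pos : 0 < Module.finrank F W' :=
          Nat.pos_of_ne_zero fun h => hW' (Submodule.finrank_eq_zero.1 h)
        have hcard' : ((insert U S).card : ℝ) ≤ S.card + 1 := by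
          exact_mod_cast Finset.card_insert_le U S
        have hm : (0 : ℝ) < Module.finrank F W := by exact_mod_cast hWpos
        have hm' : (0 : ℝ) < Module.finrank F W' := by exact_mod_cast hW'pos
        have hdimR : (Module.finrank F W : ℝ) = Module.finrank F U + Module.finrank F W' := by
          exact_mod_cast hdim
        have hUdimR : (Module.finrank F W : ℝ) ≤ K * Module.finrank F U := by
          exact_mod_cast hUdim
        have hlog := Real.log_le_sub_one_of_pos (div_pos hm' hm)
        rw [Real.log_div hm'.ne' hm.ne'] at hlog
        have hratio : (1 : ℝ) ≤ K * (1 - Module.finrank F W' / Module.finrank F W) := by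
          rw [one_sub_div hm.ne', ← mul_div_assoc, one_le_div hm]
          rwa [hdimR, add_sub_cancel_right, ← hdimR]
        have := mul_le_mul_of_nonneg_left hlog (Nat.cast_nonneg (α := ℝ) K)
        linarith

/-- The space of vectors `w` with `wᵀ A v = 0` for all `A ∈ 𝒜`. -/
def alternatingPerp {F : Type*} [Field F] {n : ℕ} (𝒜 : Submodule F (Matrix (Fin n) (Fin n) F))
    (v : Fin n → F) : Submodule F (Fin n → F) :=
  ((Submodule.span F {w : Fin n → F | ∃ A ∈ 𝒜, w = A *ᵥ v}).map
    (dotProductEquiv F (Fin n)).toLinearMap).dualCoannihilator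

theorem mem_alternatingPerp {F : Type*} [Field F] {n : ℕ}
    {𝒜 : Submodule F (Matrix (Fin n) (Fin n) F)} {v w : Fin n → F} :
    w ∈ alternatingPerp 𝒜 v ↔ ∀ A ∈ 𝒜, w ⬝ᵥ A *ᵥ v = 0 := by
  rw [alternatingPerp, Submodule.map_span, Submodule.mem_dualCoannihilator]
  constructor
  · intro h A hA
    have := h _ (Submodule.subset_span (Set.mem_image_of_mem _ ⟨A, hA, rfl⟩))
    simpa [dotProduct_comm] using this
  · intro h φ hφ
    induction hφ using Submodule.span_induction with
    | mem x hx =>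
      obtain ⟨_, ⟨A, hA, rfl⟩, rfl⟩ := hx
      simpa [dotProduct_comm] using h A hA
    | zero => simp
    | add x y _ _ hx hy => simp [hx, hy]
    | smul a x _ hx => simp [hx]

theorem finrank_span_add_finrank_alternatingPerp {F : Type*} [Field F] {n : ℕ}
    (𝒜 : Submodule F (Matrix (Fin n) (Fin n) F)) (v : Fin n → F) :
    Module.finrank F (Submodule.span F {w : Fin n → F | ∃ A ∈ 𝒜, w = A *ᵥ v}) +
      Module.finrank F (alternatingPerp 𝒜 v) = Module.finrank F (Fin n → F) := by
  rw [alternatingPerp, ← Subspace.finrank_add_finrank_dualCoannihilator_eq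
    ((Submodule.span F {w : Fin n → F | ∃ A ∈ 𝒜, w = A *ᵥ v}).map
      (dotProductEquiv F (Fin n)).toLinearMap)]
  congr 1
  exact (LinearEquiv.finrank_map_eq (dotProductEquiv F (Fin n)) _).symm

theorem dotProduct_mulVec_comm_eq_zero {F : Type*} [Field F] {n : ℕ}
    {A : Matrix (Fin n) (Fin n) F} (hA : ∀ v : Fin n → F, v ⬝ᵥ A *ᵥ v = 0) {v w : Fin n → F}
    (h : v ⬝ᵥ A *ᵥ w = 0) : w ⬝ᵥ A *ᵥ v = 0 := by
  have := hA (v + w)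
  simpa [mulVec_add, hA, h] using this

/-- There is an absolute constant `C` such that for every field `F`, every
`n ≥ 2`, and every alternating matrix space `𝒜 ≤ Λ(n,F)` with maximum degree `Δ(𝒜) ≥ 1`,
one has `χ(𝒜) ≤ C · Δ(𝒜) · log n`. -/
theorem stmt_16 :
    ∃ C : ℝ, ∀ (F : Type) [Field F] (n : ℕ), 2 ≤ n →
      ∀ 𝒜 : Submodule F (Matrix (Fin n) (Fin n) F),
        (∀ A ∈ 𝒜, ∀ v : Fin n → F, v ⬝ᵥ A *ᵥ v = 0) →
        1 ≤ sSup {d : ℕ | ∃ v : Fin n → F,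
              Module.finrank F (Submodule.span F {w : Fin n → F | ∃ A ∈ 𝒜, w = A *ᵥ v}) = d} →
        ((sInf {c : ℕ | ∃ U : Fin c → Submodule F (Fin n → F),
            (∀ i, U i ≠ ⊥) ∧
            (∀ i, ∀ u ∈ U i, ∀ u' ∈ U i, ∀ A ∈ 𝒜, u ⬝ᵥ A *ᵥ u' = 0) ∧
            DirectSum.IsInternal U} : ℕ) : ℝ)
          ≤ C * ((sSup {d : ℕ | ∃ v : Fin n → F,
              Module.finrank F (Submodule.span F {w : Fin n → F | ∃ A ∈ 𝒜, w = A *ᵥ v}) = d}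
              : ℕ) : ℝ)
            * Real.log n := by
  refine ⟨4, fun F _ n hn 𝒜 h𝒜 hΔ => ?_⟩
  set D := sSup {d : ℕ | ∃ v : Fin n → F,
    Module.finrank F (Submodule.span F {w : Fin n → F | ∃ A ∈ 𝒜, w = A *ᵥ v}) = d}
  have hdeg : ∀ v, Module.finrank F (Fin n → F) ≤ Module.finrank F (alternatingPerp 𝒜 v) + D := by
    intro v
    have hv : Module.finrank F (Submodule.span F {w : Fin n → F | ∃ A ∈ 𝒜, w = A *ᵥ v}) ≤ D := by
      refine le_csSup ⟨Module.finrank F (Fin n → F), ?_⟩ ⟨v, rfl⟩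
      rintro d ⟨u, rfl⟩
      exact Submodule.finrank_le _
    have := finrank_span_add_finrank_alternatingPerp 𝒜 v
    lia
  have hQ := exists_isotropic_le hdeg
    (fun v => mem_alternatingPerp.2 fun A hA => h𝒜 A hA v)
    (fun v w hvw => mem_alternatingPerp.2 fun A hA =>
      dotProduct_mulVec_comm_eq_zero (h𝒜 A hA) (mem_alternatingPerp.1 hvw A hA))
  have : Nonempty (Fin n) := ⟨⟨0, by lia⟩⟩
  obtain ⟨S, hS, hind, hsup, hcard⟩ := exists_supIndep_card_le_log
    (Q := fun U => ∀ u ∈ U, ∀ u' ∈ U, u ∈ alternatingPerp 𝒜 u') hQ ⊤ top_ne_bot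
  have hmem : S.card ∈ {c : ℕ | ∃ U : Fin c → Submodule F (Fin n → F),
      (∀ i, U i ≠ ⊥) ∧
      (∀ i, ∀ u ∈ U i, ∀ u' ∈ U i, ∀ A ∈ 𝒜, u ⬝ᵥ A *ᵥ u' = 0) ∧
      DirectSum.IsInternal U} := by
    refine ⟨fun i => (S.equivFin.symm i : Submodule F (Fin n → F)),
      fun i => (hS _ (S.equivFin.symm i).2).1,
      fun i u hu u' hu' => mem_alternatingPerp.1 ((hS _ (S.equivFin.symm i).2).2 u hu u' hu'), ?_⟩
    rw [DirectSum.isInternal_submodule_iff_iSupIndep_and_iSup_eq_top]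
    refine ⟨(iSupIndep_comp_coe_iff_supIndep.2 hind).comp S.equivFin.symm.injective, ?_⟩
    rw [S.equivFin.symm.iSup_comp (g := fun x : S => (x : Submodule F (Fin n → F))), ← hsup,
      Finset.sup_eq_iSup, iSup_subtype]
    rfl
  have hle : ((sInf _ : ℕ) : ℝ) ≤ S.card := Nat.cast_le.2 (Nat.sInf_le hmem)
  refine hle.trans (hcard.trans ?_)
  have hlog : Real.log 2 ≤ Real.log n := Real.log_le_log two_pos (by exact_mod_cast hn)
  have hlog2 := Real.log_two_gt_d9
  have hD1 : (1 : ℝ) ≤ D := by exact_mod_cast hΔ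
  rw [finrank_top, Module.finrank_fin_fun]
  push_cast
  nlinarith
end

section
/- There exists an absolute constant C such that the following holds. Let p be an odd prime and P a finite p-group of nilpotency class at most 2 (i.e., the commutator subgroup [P,P] is contained in the center Z(P)) and of exponent p, such that the central quotient P/Z(P) is isomorphic to (ℤ/pℤ)ⁿ. Then the number of maximal abelian subgroups of P is at most p^{n²/6 + C·n} (as real numbers). -/
open Subgroup in
/-- In a finite `p`-group, a proper inclusion of subgroups multiplies the order by at least `p`. -/
lemma IsPGroup.mul_card_le_card_of_lt {p : ℕ} [Fact p.Prime] {G : Type*} [Group G] [Finite G]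
    (hG : IsPGroup p G) {H K : Subgroup G} (h : H < K) : p * Nat.card H ≤ Nat.card K := by
  obtain ⟨k, hk⟩ := (hG.to_subgroup K).index (H.subgroupOf K)
  have hcard : H.relIndex K * Nat.card H = Nat.card K := by
    rw [mul_comm, ← relIndex_bot_left, ← relIndex_bot_left K]
    exact relIndex_mul_relIndex _ _ _ bot_le h.le
  have hk0 : k ≠ 0 := by
    rintro rfl
    exact h.not_ge (relIndex_eq_one.mp (by simpa [relIndex] using hk))
  rw [← hcard, relIndex, hk]
  exact Nat.mul_le_mul_right _ (Nat.le_self_pow hk0 p)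

open Subgroup in
/-- In a finite `p`-group, a subgroup of index larger than `p` has index at least `p ^ 2`. -/
lemma IsPGroup.sq_mul_card_le_card_of_lt {p : ℕ} [hp : Fact p.Prime] {G : Type*} [Group G]
    [Finite G] (hG : IsPGroup p G) {H : Subgroup G} (h : p * Nat.card H < Nat.card G) :
    p ^ 2 * Nat.card H ≤ Nat.card G := by
  obtain ⟨k, hk⟩ := hG.index H
  have hcard := H.card_mul_index
  rw [hk, mul_comm] at hcard
  rw [← hcard] at h ⊢
  have hk1 : p ^ 1 < p ^ k := by simpa using lt_of_mul_lt_mul_right h (Nat.zero_le _)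
  have := (Nat.pow_lt_pow_iff_right hp.out.one_lt).mp hk1
  exact Nat.mul_le_mul_right _ (Nat.pow_le_pow_right hp.out.pos this)

namespace Subgroup

/-- An abelian subgroup is maximal among abelian subgroups iff it is its own centralizer. -/
lemma centralizer_eq_self_iff_maximal_abelian {G : Type*} [Group G] (H : Subgroup G) :
    centralizer (H : Set G) = H ↔
      (∀ a ∈ H, ∀ b ∈ H, a * b = b * a) ∧
        ∀ K : Subgroup G, (∀ a ∈ K, ∀ b ∈ K, a * b = b * a) → H ≤ K → K = H := by
  constructor
  · intro h
    refine ⟨fun a ha b hb => ?_, fun K hK hHK => le_antisymm (fun x hx => ?_) hHK⟩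
    · rw [← h] at hb
      exact mem_centralizer_iff.mp hb a ha
    · rw [← h, mem_centralizer_iff]
      exact fun y hy => hK y (hHK hy) x hx
  · rintro ⟨hab, hmax⟩
    have hle : H ≤ centralizer (H : Set G) := fun x hx =>
      mem_centralizer_iff.mpr fun y hy => hab y hy x hx
    refine le_antisymm (fun u hu => ?_) hle
    have hcomm : ∀ a ∈ closure (insert u (H : Set G)), ∀ b ∈ closure (insert u (H : Set G)),
        a * b = b * a := by
      have hset : ∀ x ∈ insert u (H : Set G), ∀ y ∈ insert u (H : Set G), x * y = y * x := by
        rintro x (rfl | hx) y (rfl | hy)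
        · rfl
        · exact (mem_centralizer_iff.mp hu y hy).symm
        · exact mem_centralizer_iff.mp hu x hx
        · exact hab x hx y hy
      have := isMulCommutative_closure hset
      exact fun a ha b hb => congrArg Subtype.val (mul_comm' (⟨a, ha⟩ : closure _) ⟨b, hb⟩)
    have hHK : H ≤ closure (insert u (H : Set G)) := fun x hx =>
      subset_closure (Set.mem_insert_of_mem _ hx)
    rw [← hmax _ hcomm hHK]
    exact subset_closure (Set.mem_insert _ _)

/-- If every element of a subgroup `A` containing the center has at most `p` conjugates, then
`|G : C(A)| ≤ |A : Z(G)|`. -/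
lemma card_mul_card_center_le {p : ℕ} [hp : Fact p.Prime] {G : Type*} [Group G] [Finite G]
    (hG : IsPGroup p G) {A : Subgroup G} (hZ : center G ≤ A)
    (hA : ∀ u ∈ A, Nat.card G ≤ p * Nat.card (centralizer ({u} : Set G))) :
    Nat.card G * Nat.card (center G) ≤ Nat.card (centralizer (A : Set G)) * Nat.card A := by
  have hfin : {B : Subgroup G | center G ≤ B ∧ B ≤ A ∧ Nat.card G * Nat.card (center G) ≤
      Nat.card (centralizer (B : Set G)) * Nat.card B}.Finite := Set.toFinite _
  have hne : {B : Subgroup G | center G ≤ B ∧ B ≤ A ∧ Nat.card G * Nat.card (center G) ≤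
      Nat.card (centralizer (B : Set G)) * Nat.card B}.Nonempty := by
    refine ⟨center G, le_rfl, hZ, ?_⟩
    rw [centralizer_eq_top_iff_subset.mpr le_rfl, card_top]
  obtain ⟨B, ⟨hZB, hBA, hB⟩, hmax⟩ := hfin.exists_maximal hne
  rcases hBA.eq_or_lt with rfl | hlt
  · exact hB
  exfalso
  obtain ⟨u, huA, huB⟩ := SetLike.exists_of_lt hlt
  have hBu : B < B ⊔ zpowers u := by
    refine lt_of_le_of_ne le_sup_left fun h => huB ?_
    rw [h]
    exact le_sup_right (a := B) (mem_zpowers u)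
  have hC : centralizer (B : Set G) ⊓ centralizer {u} ≤
      centralizer ((B ⊔ zpowers u : Subgroup G) : Set G) := by
    rw [le_centralizer_iff]
    refine sup_le (le_centralizer_iff.mp inf_le_left) ?_
    rw [zpowers_le]
    exact mem_centralizer_iff.mpr fun y hy => (mem_centralizer_iff.mp hy.2 u rfl).symm
  have h1 : Nat.card (centralizer (B : Set G)) ≤
      p * Nat.card (centralizer ((B ⊔ zpowers u : Subgroup G) : Set G)) := by
    have e1 : (centralizer {u}).relIndex (centralizer (B : Set G)) *
        Nat.card (centralizer (B : Set G) ⊓ centralizer {u} : Subgroup G) =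
        Nat.card (centralizer (B : Set G)) := by
      rw [← inf_relIndex_left, mul_comm, ← relIndex_bot_left,
        ← relIndex_bot_left (centralizer (B : Set G))]
      exact relIndex_mul_relIndex _ _ _ bot_le inf_le_left
    have e2 : (centralizer ({u} : Set G)).index ≤ p := by
      have := hA u huA
      rw [← card_mul_index (centralizer ({u} : Set G)), mul_comm] at this
      exact le_of_mul_le_mul_right this Nat.card_pos
    have e3 : (centralizer ({u} : Set G)).relIndex (centralizer (B : Set G)) ≤
        (centralizer ({u} : Set G)).index := by
      rw [← relIndex_top_right]
      exact relIndex_le_of_le_right le_top (by simp [index_ne_zero_of_finite])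
    rw [← e1]
    exact Nat.mul_le_mul (e3.trans e2) (card_le_of_le hC)
  have h2 := hG.mul_card_le_card_of_lt hBu
  refine hBu.not_ge (hmax ⟨hZB.trans le_sup_left, sup_le hBA (by simpa using huA), ?_⟩ hBu.le)
  calc _ ≤ _ := hB
    _ ≤ (p * Nat.card (centralizer ((B ⊔ zpowers u : Subgroup G) : Set G))) * Nat.card B :=
        Nat.mul_le_mul_right _ h1
    _ = Nat.card (centralizer ((B ⊔ zpowers u : Subgroup G) : Set G)) * (p * Nat.card B) := by ring
    _ ≤ _ := Nat.mul_le_mul_left _ h2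

/-- Self-centralizing subgroups containing `u` inject into the self-centralizing subgroups of the
centralizer of `u`. -/
lemma card_selfCentralizing_mem_le {G : Type*} [Group G] [Finite G] (u : G) :
    Nat.card {A : Subgroup G // centralizer (A : Set G) = A ∧ u ∈ A} ≤
      Nat.card {B : Subgroup (centralizer ({u} : Set G)) //
        centralizer (B : Set (centralizer ({u} : Set G))) = B} := by
  have hle : ∀ A : Subgroup G, centralizer (A : Set G) = A → u ∈ A → A ≤ centralizer {u} := by
    intro A hA hu
    conv_lhs => rw [← hA]
    exact centralizer_le (by simpa using hu)
  refine Nat.card_le_card_of_injective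
    (fun A => ⟨A.1.subgroupOf (centralizer {u}), ?_⟩) ?_
  · obtain ⟨A, hA, hu⟩ := A
    dsimp only
    ext x
    constructor
    · intro hx
      rw [mem_subgroupOf, ← hA, mem_centralizer_iff]
      intro a ha
      exact congrArg Subtype.val
        (mem_centralizer_iff.mp hx ⟨a, hle A hA hu ha⟩ (mem_subgroupOf.mpr ha))
    · intro hx
      rw [mem_subgroupOf, ← hA, mem_centralizer_iff] at hx
      exact mem_centralizer_iff.mpr fun a ha => Subtype.ext (hx a ha)
  · rintro ⟨A, hA, hu⟩ ⟨B, hB, hv⟩ h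
    have := congrArg Subtype.val h
    simp only [subgroupOf_inj] at this
    rw [inf_of_le_left (hle A hA hu), inf_of_le_left (hle B hB hv)] at this
    exact Subtype.ext this

/-- Passing to the centralizer of a noncentral element lowers the exponent of the index of the
center by one plus the exponent of the index of this centralizer. -/
lemma card_centralizer_le_pow_mul_card_center {p : ℕ} [hp : Fact p.Prime] {G : Type*} [Group G]
    [Finite G] (hG : IsPGroup p G) {n a : ℕ} (hn : Nat.card G ≤ p ^ n * Nat.card (center G))
    {u : G} (hu : u ∉ center G)
    (ha : p ^ a * Nat.card (centralizer ({u} : Set G)) ≤ Nat.card G) :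
    a + 1 ≤ n ∧ Nat.card (centralizer ({u} : Set G)) ≤
      p ^ (n - (a + 1)) * Nat.card (center (centralizer ({u} : Set G))) := by
  set K := centralizer ({u} : Set G) with hK
  have huK : u ∈ K := mem_centralizer_iff.mpr (by simp)
  have hlt : center G < (center K).map K.subtype := by
    refine lt_of_le_of_ne (fun z hz => ?_) fun h => hu ?_
    · refine ⟨⟨z, center_le_centralizer _ hz⟩, ?_, rfl⟩
      exact mem_center_iff.mpr fun g => Subtype.ext (mem_center_iff.mp hz g)
    · rw [h]
      refine ⟨⟨u, huK⟩, mem_center_iff.mpr fun g => Subtype.ext ?_, rfl⟩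
      exact (mem_centralizer_iff.mp g.2 u rfl).symm
  have h1 := hG.mul_card_le_card_of_lt hlt
  rw [card_map_of_injective K.subtype_injective] at h1
  have h2 : p ^ (a + 1) * Nat.card K ≤ p ^ n * Nat.card (center K) := by
    calc p ^ (a + 1) * Nat.card K = p * (p ^ a * Nat.card K) := by ring
      _ ≤ p * (p ^ n * Nat.card (center G)) := Nat.mul_le_mul_left _ (ha.trans hn)
      _ = p ^ n * (p * Nat.card (center G)) := by ring
      _ ≤ _ := Nat.mul_le_mul_left _ h1
  have han : a + 1 ≤ n := by
    have : p ^ (a + 1) * Nat.card K ≤ p ^ n * Nat.card K :=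
      h2.trans (Nat.mul_le_mul_left _ (card_le_card_group _))
    exact (Nat.pow_le_pow_iff_right hp.out.one_lt).mp (le_of_mul_le_mul_right this Nat.card_pos)
  refine ⟨han, ?_⟩
  obtain ⟨m, rfl⟩ := Nat.exists_eq_add_of_le han
  rw [pow_add p (a + 1) m, mul_assoc (p ^ (a + 1))] at h2
  simpa using le_of_mul_le_mul_left h2 (pow_pos hp.out.pos _)

open Classical in
/-- The subgroups having an element with more than `p` conjugates, counted through these
elements. -/
lemma card_mul_card_center_le_of_exists {p : ℕ} {G : Type*} [Group G] [Fintype G]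
    (S : Finset (Subgroup G)) (hZ : ∀ A ∈ S, center G ≤ A)
    (hS : ∀ A ∈ S, ∃ u ∈ A, p * Nat.card (centralizer ({u} : Set G)) < Nat.card G) {c : ℝ}
    (hc : ∀ u : G, p * Nat.card (centralizer ({u} : Set G)) < Nat.card G →
      ((S.filter (u ∈ ·)).card : ℝ) ≤ c) (hc0 : 0 ≤ c) :
    (S.card : ℝ) * Nat.card (center G) ≤ Nat.card G * c := by
  set U : Finset G := Finset.univ.filter
    fun u => p * Nat.card (centralizer ({u} : Set G)) < Nat.card G with hU
  have hcount := Finset.card_nsmul_le_card_nsmul (R := ℝ) (s := S) (t := U)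
    (m := Nat.card (center G)) (n := c) (fun A u => u ∈ A) ?_ ?_
  · simp only [nsmul_eq_mul] at hcount
    refine hcount.trans (mul_le_mul_of_nonneg_right ?_ hc0)
    rw [Nat.card_eq_fintype_card]
    exact_mod_cast Finset.card_le_univ U
  · intro A hA
    obtain ⟨u, huA, hu⟩ := hS A hA
    have hcard : ((Finset.univ.filter (· ∈ center G)).image (u * ·)).card =
        Nat.card (center G) := by
      rw [Finset.card_image_of_injective _ (mul_right_injective u), Nat.card_eq_fintype_card,
        ← Fintype.card_subtype]
    rw [← hcard]
    refine Nat.cast_le.mpr (Finset.card_le_card ?_)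
    intro x hx
    obtain ⟨z, hz, rfl⟩ := Finset.mem_image.mp hx
    replace hz : z ∈ center G := by simpa using hz
    have hC : centralizer ({u * z} : Set G) = centralizer {u} := by
      ext g
      have hzg := mem_center_iff.mp hz g
      simp only [mem_centralizer_singleton_iff]
      rw [← mul_assoc, mul_assoc u z g, ← hzg, ← mul_assoc, mul_left_inj]
    simp only [Finset.mem_bipartiteAbove, hU, Finset.mem_filter, Finset.mem_univ, true_and]
    exact ⟨by rwa [hC], A.mul_mem huA (hZ A hA hz)⟩
  · intro u hu
    exact hc u (by simpa [hU] using hu)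

open Classical in
/-- Self-centralizing subgroups all of whose elements have at most `p` conjugates, counted through
their noncentral elements. -/
lemma card_mul_sqrt_le_of_forall {p : ℕ} [hp : Fact p.Prime] {G : Type*} [Group G] [Fintype G]
    (hG : IsPGroup p G) (hab : center G ≠ ⊤) (S : Finset (Subgroup G))
    (hself : ∀ A ∈ S, centralizer (A : Set G) = A)
    (hS : ∀ A ∈ S, ∀ u ∈ A, Nat.card G ≤ p * Nat.card (centralizer ({u} : Set G))) {c : ℝ}
    (hc : ∀ u : G, u ∉ center G → ((S.filter (u ∈ ·)).card : ℝ) ≤ c) (hc0 : 0 ≤ c) :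
    (S.card : ℝ) * (√(Nat.card G * Nat.card (center G)) / 2) ≤ Nat.card G * c := by
  have hcount := Finset.card_nsmul_le_card_nsmul (R := ℝ) (s := S)
    (t := Finset.univ.filter (· ∉ center G))
    (m := √(Nat.card G * Nat.card (center G)) / 2) (n := c) (fun A u => u ∈ A) ?_ ?_
  · simp only [nsmul_eq_mul] at hcount
    refine hcount.trans (mul_le_mul_of_nonneg_right ?_ hc0)
    rw [Nat.card_eq_fintype_card]
    exact_mod_cast Finset.card_le_univ _
  · intro A hA
    have hZ : center G ≤ A := hself A hA ▸ center_le_centralizer _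
    have hlt : center G < A := by
      refine lt_of_le_of_ne hZ fun h => hab ?_
      have := hself A hA
      rw [← h, centralizer_eq_top_iff_subset.mpr le_rfl] at this
      exact this.symm
    have h2 := (Nat.mul_le_mul_right _ hp.out.two_le).trans (hG.mul_card_le_card_of_lt hlt)
    have hsq := card_mul_card_center_le hG hZ (hS A hA)
    rw [hself A hA] at hsq
    have hsqrt : √(Nat.card G * Nat.card (center G) : ℝ) ≤ Nat.card A := by
      refine Real.sqrt_le_iff.mpr ⟨Nat.cast_nonneg _, ?_⟩
      rw [sq]
      exact_mod_cast hsq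
    have hcard : Nat.card A ≤ ((Finset.univ.filter (· ∉ center G)).bipartiteAbove
        (fun (A : Subgroup G) u => u ∈ A) A).card + Nat.card (center G) := by
      have e1 : Nat.card A = (Finset.univ.filter (· ∈ A)).card := by
        rw [Nat.card_eq_fintype_card, ← Fintype.card_subtype]
      have e2 : Nat.card (center G) = (Finset.univ.filter (· ∈ center G)).card := by
        rw [Nat.card_eq_fintype_card, ← Fintype.card_subtype]
      rw [e1, e2]
      refine (Finset.card_le_card fun x hx => ?_).trans (Finset.card_union_le _ _)
      by_cases hxZ : x ∈ center G <;> simp_all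
    have hcard' : (Nat.card A : ℝ) ≤ ((Finset.univ.filter (· ∉ center G)).bipartiteAbove
        (fun (A : Subgroup G) u => u ∈ A) A).card + Nat.card (center G) := by
      exact_mod_cast hcard
    have h2' : (2 : ℝ) * Nat.card (center G) ≤ Nat.card A := by exact_mod_cast h2
    linarith
  · intro u hu
    exact hc u (by simpa using hu)

end Subgroup

lemma natCast_pow_mul_rpow_le_half {p : ℝ} (hp : 2 ≤ p) {n : ℕ} (hn : 3 ≤ n) :
    p ^ n * p ^ (((n - 3 : ℕ) : ℝ) ^ 2 / 6 + 2 * ((n - 3 : ℕ) : ℝ)) ≤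
      p ^ ((n : ℝ) ^ 2 / 6 + 2 * n) / 2 := by
  have hp0 : 0 < p := by linarith
  rw [← Real.rpow_natCast p n, ← Real.rpow_add hp0, Nat.cast_sub hn]
  calc _ ≤ p ^ ((n : ℝ) ^ 2 / 6 + 2 * n - 1) := by
        refine Real.rpow_le_rpow_of_exponent_le (by linarith) ?_
        push_cast
        linarith
    _ = p ^ ((n : ℝ) ^ 2 / 6 + 2 * n) / p := by rw [Real.rpow_sub hp0, Real.rpow_one]
    _ ≤ _ := by gcongr

lemma two_mul_sqrt_pow_mul_rpow_le_half {p : ℝ} (hp : 2 ≤ p) {n : ℕ} (hn : 2 ≤ n) :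
    2 * √(p ^ n) * p ^ (((n - 2 : ℕ) : ℝ) ^ 2 / 6 + 2 * ((n - 2 : ℕ) : ℝ)) ≤
      p ^ ((n : ℝ) ^ 2 / 6 + 2 * n) / 2 := by
  have hp0 : 0 < p := by linarith
  have hn' : (2 : ℝ) ≤ n := by exact_mod_cast hn
  rw [Real.sqrt_eq_rpow, ← Real.rpow_natCast p n, ← Real.rpow_mul hp0.le, mul_assoc,
    ← Real.rpow_add hp0, Nat.cast_sub hn]
  have h : p ^ ((n : ℝ) * (1 / 2) + (((n : ℝ) - (2 : ℕ)) ^ 2 / 6 + 2 * ((n : ℝ) - (2 : ℕ)))) ≤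
      p ^ ((n : ℝ) ^ 2 / 6 + 2 * n) / 4 := by
    calc _ ≤ p ^ ((n : ℝ) ^ 2 / 6 + 2 * n - (2 : ℕ)) := by
          refine Real.rpow_le_rpow_of_exponent_le (by linarith) ?_
          push_cast
          linarith
      _ = p ^ ((n : ℝ) ^ 2 / 6 + 2 * n) / p ^ 2 := by
          rw [Real.rpow_sub hp0, Real.rpow_natCast]
      _ ≤ _ := by
          gcongr
          nlinarith
  linarith

open Subgroup Classical in
/-- A finite `p`-group whose center has index at most `p ^ n` has at most `p ^ (n ^ 2 / 6 + 2 * n)`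
self-centralizing subgroups. -/
theorem IsPGroup.card_selfCentralizing_le {p : ℕ} [hp : Fact p.Prime] (n : ℕ) :
    ∀ (G : Type*) [Group G] [Finite G], IsPGroup p G →
      Nat.card G ≤ p ^ n * Nat.card (center G) →
      (Nat.card {A : Subgroup G // centralizer (A : Set G) = A} : ℝ) ≤
        (p : ℝ) ^ ((n : ℝ) ^ 2 / 6 + 2 * n) := by
  induction n using Nat.strong_induction_on with
  | _ n ih =>
  intro G _ _ hG hn
  have := Fintype.ofFinite G
  have hp2 : (2 : ℝ) ≤ p := by exact_mod_cast hp.out.two_le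
  have hp1 : (1 : ℝ) ≤ p := by linarith
  have hZpos : (0 : ℝ) < Nat.card (center G) := by exact_mod_cast Nat.card_pos
  have hGpos : (0 : ℝ) < Nat.card G := by exact_mod_cast Nat.card_pos
  have hnR : (Nat.card G : ℝ) ≤ (p : ℝ) ^ n * Nat.card (center G) := by exact_mod_cast hn
  by_cases hab : center G = ⊤
  · have hsub : Subsingleton {A : Subgroup G // centralizer (A : Set G) = A} := by
      refine ⟨fun A B => Subtype.ext ?_⟩
      have h : ∀ A : Subgroup G, centralizer (A : Set G) = A → A = ⊤ := fun A hA =>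
        hA ▸ top_le_iff.mp (hab ▸ center_le_centralizer _)
      rw [h _ A.2, h _ B.2]
    calc (Nat.card {A : Subgroup G // centralizer (A : Set G) = A} : ℝ) ≤ 1 := by
          exact_mod_cast Finite.card_le_one_iff_subsingleton.mpr hsub
      _ ≤ _ := Real.one_le_rpow hp1 (by positivity)
  set T : Finset (Subgroup G) := Finset.univ.filter fun A => centralizer (A : Set G) = A with hT
  have hTcard : Nat.card {A : Subgroup G // centralizer (A : Set G) = A} = T.card := by
    rw [Nat.card_eq_fintype_card, Fintype.card_subtype]
  have key : ∀ (a : ℕ) (u : G), u ∉ center G →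
      p ^ a * Nat.card (centralizer ({u} : Set G)) ≤ Nat.card G →
      a + 1 ≤ n ∧ ∀ S ⊆ T, ((S.filter (u ∈ ·)).card : ℝ) ≤
        (p : ℝ) ^ (((n - (a + 1) : ℕ) : ℝ) ^ 2 / 6 + 2 * ((n - (a + 1) : ℕ) : ℝ)) := by
    intro a u hu ha
    obtain ⟨han, hle⟩ := card_centralizer_le_pow_mul_card_center hG hn hu ha
    refine ⟨han, fun S hS => le_trans ?_ (ih _ (by omega) _ (hG.to_subgroup _) hle)⟩
    refine Nat.cast_le.mpr (le_trans ?_ (card_selfCentralizing_mem_le u))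
    rw [Nat.card_eq_fintype_card, Fintype.card_subtype]
    refine Finset.card_le_card fun A hA => ?_
    obtain ⟨hAS, huA⟩ := Finset.mem_filter.mp hA
    exact Finset.mem_filter.mpr ⟨Finset.mem_univ _, (Finset.mem_filter.mp (hS hAS)).2, huA⟩
  have hself : ∀ A ∈ T, centralizer (A : Set G) = A := fun A hA => (Finset.mem_filter.mp hA).2
  have hproper : ∀ u : G, u ∉ center G → centralizer ({u} : Set G) < ⊤ := by
    refine fun u hu => lt_top_iff_ne_top.mpr fun h => hu ?_
    simpa using centralizer_eq_top_iff_subset.mp h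
  set Q : Subgroup G → Prop :=
    fun A => ∃ u ∈ A, p * Nat.card (centralizer ({u} : Set G)) < Nat.card G with hQ
  have hlarge : ((T.filter Q).card : ℝ) ≤ (p : ℝ) ^ ((n : ℝ) ^ 2 / 6 + 2 * n) / 2 := by
    have hnc : ∀ u : G, p * Nat.card (centralizer ({u} : Set G)) < Nat.card G →
        u ∉ center G := by
      intro u hu hmem
      rw [centralizer_eq_top_iff_subset.mpr (by simpa using hmem), card_top] at hu
      exact absurd hu (not_lt.mpr (Nat.le_mul_of_pos_left _ hp.out.pos))
    rcases (T.filter Q).eq_empty_or_nonempty with h0 | ⟨A, hA⟩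
    · rw [h0]
      simp only [Finset.card_empty, Nat.cast_zero]
      positivity
    obtain ⟨u, -, hu⟩ := (Finset.mem_filter.mp hA).2
    have hn3 : 3 ≤ n := (key 2 u (hnc u hu) (hG.sq_mul_card_le_card_of_lt hu)).1
    have h := card_mul_card_center_le_of_exists (T.filter Q)
      (fun A hA => hself A (Finset.mem_of_mem_filter A hA) ▸ center_le_centralizer _)
      (fun A hA => (Finset.mem_filter.mp hA).2)
      (fun u hu => (key 2 u (hnc u hu) (hG.sq_mul_card_le_card_of_lt hu)).2 _
        (Finset.filter_subset _ _)) (by positivity)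
    refine le_trans ?_ (natCast_pow_mul_rpow_le_half hp2 hn3)
    refine le_of_mul_le_mul_right (h.trans ?_) hZpos
    calc _ ≤ _ := mul_le_mul_of_nonneg_right hnR (by positivity)
      _ = _ := by ring
  have hsmall : ((T.filter (¬ Q ·)).card : ℝ) ≤ (p : ℝ) ^ ((n : ℝ) ^ 2 / 6 + 2 * n) / 2 := by
    have hindex : ∀ u : G, u ∉ center G →
        p ^ 1 * Nat.card (centralizer ({u} : Set G)) ≤ Nat.card G := fun u hu => by
      simpa using hG.mul_card_le_card_of_lt (hproper u hu)
    obtain ⟨u, -, hu⟩ := SetLike.exists_of_lt (lt_top_iff_ne_top.mpr hab)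
    have hn2 : 2 ≤ n := (key 1 u hu (hindex u hu)).1
    have h := card_mul_sqrt_le_of_forall hG hab (T.filter (¬ Q ·))
      (fun A hA => hself A (Finset.mem_of_mem_filter A hA))
      (fun A hA u hu => not_lt.mp fun hlt => (Finset.mem_filter.mp hA).2 ⟨u, hu, hlt⟩)
      (fun u hu => (key 1 u hu (hindex u hu)).2 _ (Finset.filter_subset _ _)) (by positivity)
    refine le_trans ?_ (two_mul_sqrt_pow_mul_rpow_le_half hp2 hn2)
    have hsqrt : (0 : ℝ) < √(Nat.card G * Nat.card (center G)) / 2 := by positivity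
    refine le_of_mul_le_mul_right (h.trans ?_) hsqrt
    have hG' : (Nat.card G : ℝ) ≤ √(p ^ n) * √(Nat.card G * Nat.card (center G)) := by
      rw [← Real.sqrt_mul (by positivity)]
      refine Real.le_sqrt_of_sq_le ?_
      nlinarith
    calc _ ≤ _ := mul_le_mul_of_nonneg_right hG' (by positivity)
      _ = _ := by ring
  rw [hTcard, ← Finset.card_filter_add_card_filter_not (s := T) Q, Nat.cast_add]
  linarith


/-- There is an absolute constant `C` such that for every odd prime `p` and every
finite `p`-group `P` of nilpotency class at most 2 and exponent `p` with `P/Z(P) ≅ (ℤ/pℤ)ⁿ`,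
the number of maximal abelian subgroups of `P` is at most `p^{n²/6 + C·n}` (as real numbers). -/
theorem stmt_17 :
    ∃ C : ℝ, ∀ (p : ℕ), p.Prime → Odd p →
      ∀ (P : Type) [Group P] [Finite P], IsPGroup p P →
        commutator P ≤ Subgroup.center P →
        (∀ g : P, g ^ p = 1) →
        ∀ n : ℕ,
          Nonempty ((P ⧸ Subgroup.center P) ≃* Multiplicative (Fin n → ZMod p)) →
          (Nat.card {H : Subgroup P //
              (∀ a ∈ H, ∀ b ∈ H, a * b = b * a) ∧
              (∀ K : Subgroup P, (∀ a ∈ K, ∀ b ∈ K, a * b = b * a) → H ≤ K → K = H)} : ℝ)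
            ≤ (p : ℝ) ^ ((n : ℝ) ^ 2 / 6 + C * n) := by
  refine ⟨2, fun p hp _ P _ _ hP _ _ n ⟨e⟩ => ?_⟩
  have : Fact p.Prime := ⟨hp⟩
  have hquot : Nat.card (P ⧸ Subgroup.center P) = p ^ n := by
    rw [Nat.card_congr e.toEquiv, Nat.card_congr Multiplicative.toAdd]
    simp
  have hcard : Nat.card P ≤ p ^ n * Nat.card (Subgroup.center P) := by
    rw [Subgroup.card_eq_card_quotient_mul_card_subgroup (Subgroup.center P), hquot]
  rw [← Nat.card_congr (Equiv.subtypeEquivRight Subgroup.centralizer_eq_self_iff_maximal_abelian)]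
  exact IsPGroup.card_selfCentralizing_le n P hP hcard
end
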